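/- arXiv:2106.03880 — 2 statements merged into one kernel-verified Lean document; each statement's English description precedes it below -/
import Mathlib

section
/- For every δ ∈ (0,1), every m ≥ 1, and every probability measure P on [0,2π)^d × ℝ, the m-fold product measure P^m gives probability at least 1 − δ to the set of samples S = ((x₁,y₁),…,(x_m,y_m)) such that for all f ∈ H_Ω^{B̃}: R(f) − R̂_S(f) ≤ 2L · min{ (1/√m)·(2π·max{K, B̃·√(|Ω₊|)}·√(2·log(2d)) + max{π, B̃}), B̃/√m + 2·B̃·√(2·|Ω|·log(|Ω|))/√m } + 3c·√( log(2/δ) / (2m) ). -/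
open Real MeasureTheory
open scoped ENNReal NNReal BigOperators

noncomputable section

/-- The domain `[0, 2π)^d`. -/
def box (d : ℕ) : Set (Fin d → ℝ) := Set.univ.pi fun _ => Set.Ico 0 (2 * π)

/-- Euclidean dot product `ω · x`. -/
def dot {d : ℕ} (ω x : Fin d → ℝ) : ℝ := ∑ j, ω j * x j

/-- The sign `±1` associated with a Boolean. -/
def signOf (b : Bool) : ℝ := if b then 1 else -1

/-- Empirical Rademacher complexity of a class `F` of real-valued functions with
respect to the sample points `x₁, …, x_m`:
`2^{-m} Σ_{σ ∈ {−1,1}^m} sup_{f ∈ F} (1/m) Σ_i σ_i f(x_i)`. -/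
def empRad {X : Type*} {m : ℕ} (F : Set (X → ℝ)) (x : Fin m → X) : ℝ :=
  (1 / 2 ^ m) * ∑ σ : Fin m → Bool,
    sSup ((fun f => (1 / (m : ℝ)) * ∑ i, signOf (σ i) * f (x i)) '' F)

/-- The Euclidean 2-norm of the coefficient vector `(a₀, (a_ω)_{ω∈Ω₊}, (b_ω)_{ω∈Ω₊})`. -/
def coeffNorm2 {d : ℕ} (Ωp : Finset (Fin d → ℝ)) (a0 : ℝ) (a b : (Fin d → ℝ) → ℝ) : ℝ :=
  Real.sqrt (a0 ^ 2 + ∑ ω ∈ Ωp, (a ω ^ 2 + b ω ^ 2))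

/-- The generalized trigonometric polynomial with frequencies in `Ω₊` and
coefficients `a₀, (a_ω), (b_ω)`:
`x ↦ a₀/2 + Σ_{ω∈Ω₊} (a_ω cos(ω·x) + b_ω sin(ω·x))`. -/
def gtp {d : ℕ} (Ωp : Finset (Fin d → ℝ)) (a0 : ℝ) (a b : (Fin d → ℝ) → ℝ) :
    (Fin d → ℝ) → ℝ :=
  fun x => a0 / 2 + ∑ ω ∈ Ωp, (a ω * Real.cos (dot ω x) + b ω * Real.sin (dot ω x))

/-- The class `H_Ω^{B̃}` of generalized trigonometric polynomials with frequencies in `Ω₊`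
whose coefficient vector has Euclidean 2-norm at most `B̃`. -/
def Hclass {d : ℕ} (Ωp : Finset (Fin d → ℝ)) (Bt : ℝ) : Set ((Fin d → ℝ) → ℝ) :=
  { f | ∃ a0 a b, coeffNorm2 Ωp a0 a b ≤ Bt ∧ f = gtp Ωp a0 a b }

/-- `K = Σ_{i=1}^d max_{ω∈Ω₊} |ω_i|`. -/
def Kconst {d : ℕ} (Ωp : Finset (Fin d → ℝ)) (hne : Ωp.Nonempty) : ℝ :=
  ∑ i, Ωp.sup' hne fun ω => |ω i|

end

noncomputable section

/-- The (true) risk `R(f) = ∫ ℓ(y, f(x)) dP(x,y)`. -/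
def risk {d : ℕ} (P : Measure ((Fin d → ℝ) × ℝ)) (ℓ : ℝ → ℝ → ℝ)
    (f : (Fin d → ℝ) → ℝ) : ℝ :=
  ∫ p, ℓ p.2 (f p.1) ∂P

/-- The empirical risk `R̂_S(f) = (1/m) Σ_i ℓ(y_i, f(x_i))` on the sample `S`. -/
def empRisk {d m : ℕ} (ℓ : ℝ → ℝ → ℝ) (S : Fin m → (Fin d → ℝ) × ℝ)
    (f : (Fin d → ℝ) → ℝ) : ℝ :=
  (1 / (m : ℝ)) * ∑ i, ℓ (S i).2 (f (S i).1)

end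

lemma abs_ciSup_sub_ciSup_le {κ : Type*} [Finite κ] [Nonempty κ] {F G : κ → ℝ} {a : ℝ}
    (h : ∀ k, |F k - G k| ≤ a) : |(⨆ k, F k) - ⨆ k, G k| ≤ a := by
  rw [abs_sub_le_iff]
  constructor
  · rw [sub_le_iff_le_add]
    refine ciSup_le fun k => ?_
    have := (abs_sub_le_iff.1 (h k)).1
    have := le_ciSup (Set.finite_range G).bddAbove k
    linarith
  · rw [sub_le_iff_le_add]
    refine ciSup_le fun k => ?_
    have := (abs_sub_le_iff.1 (h k)).2
    have := le_ciSup (Set.finite_range F).bddAbove k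
    linarith

@[simp] lemma signOf_true : signOf true = 1 := rfl

@[simp] lemma signOf_false : signOf false = -1 := rfl

lemma signOf_not (b : Bool) : signOf (!b) = -signOf b := by cases b <;> simp

lemma abs_signOf (b : Bool) : |signOf b| = 1 := by cases b <;> simp

/-- The average of a function over all sign patterns. -/
noncomputable def signAvg {m : ℕ} (F : (Fin m → Bool) → ℝ) : ℝ := (1 / 2 ^ m) * ∑ σ, F σ

lemma signAvg_mono {m : ℕ} {F G : (Fin m → Bool) → ℝ} (h : ∀ σ, F σ ≤ G σ) :
    signAvg F ≤ signAvg G := by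
  unfold signAvg
  gcongr
  exact h _

lemma signAvg_add {m : ℕ} (F G : (Fin m → Bool) → ℝ) :
    signAvg (fun σ => F σ + G σ) = signAvg F + signAvg G := by
  simp [signAvg, Finset.sum_add_distrib, mul_add]

lemma signAvg_const_mul {m : ℕ} (a : ℝ) (F : (Fin m → Bool) → ℝ) :
    signAvg (fun σ => a * F σ) = a * signAvg F := by
  simp only [signAvg, ← Finset.mul_sum]
  ring

lemma signAvg_const {m : ℕ} (a : ℝ) : signAvg (fun _ : Fin m → Bool => a) = a := by
  simp [signAvg]

lemma signAvg_zero (F : (Fin 0 → Bool) → ℝ) (σ : Fin 0 → Bool) : signAvg F = F σ := by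
  simp only [signAvg, pow_zero, div_one, one_mul, Fintype.sum_unique]
  exact congrArg F (Subsingleton.elim _ _)

lemma signAvg_succ {m : ℕ} (F : (Fin (m + 1) → Bool) → ℝ) :
    signAvg F = signAvg fun τ : Fin m → Bool =>
      (F (Fin.cons true τ : Fin (m + 1) → Bool) + F (Fin.cons false τ : Fin (m + 1) → Bool)) / 2 := by
  unfold signAvg
  rw [← Equiv.sum_comp (Fin.consEquiv fun _ : Fin (m + 1) => Bool) F, Fintype.sum_prod_type,
    Fintype.sum_bool, ← Finset.sum_add_distrib, ← Finset.sum_div, pow_succ]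
  simp only [Fin.consEquiv, Equiv.coe_fn_mk]
  field_simp

lemma signAvg_comp_not {m : ℕ} (F : (Fin m → Bool) → ℝ) :
    signAvg (fun σ => F fun i => !σ i) = signAvg F := by
  unfold signAvg
  congr 1
  exact Equiv.sum_comp (Equiv.piCongrRight fun _ : Fin m => Equiv.boolNot) F

lemma sum_signOf_cons {m : ℕ} {E : Type*} [AddCommGroup E] [Module ℝ E] (b : Bool)
    (τ : Fin m → Bool) (v : Fin (m + 1) → E) :
    ∑ i, signOf ((Fin.cons b τ : Fin (m + 1) → Bool) i) • v i =
      signOf b • v 0 + ∑ i : Fin m, signOf (τ i) • v i.succ := by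
  simp [Fin.sum_univ_succ]

/-- Bounded differences inequality on the discrete cube, in exponential moment form. -/
lemma signAvg_exp_le {m : ℕ} (G : (Fin m → Bool) → ℝ) (a : ℝ)
    (hG : ∀ σ i b, |G (Function.update σ i b) - G σ| ≤ a) :
    signAvg (fun σ => exp (G σ)) ≤ exp (signAvg G + m * a ^ 2 / 8) := by
  induction m with
  | zero =>
    rw [signAvg_zero _ (fun _ => true), signAvg_zero _ (fun _ => true)]
    simp
  | succ m ih =>
    rw [signAvg_succ, signAvg_succ G]
    set H : (Fin m → Bool) → ℝ := fun τ =>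
      (G (Fin.cons true τ : Fin (m + 1) → Bool) + G (Fin.cons false τ : Fin (m + 1) → Bool)) / 2
      with hH
    have step : ∀ τ : Fin m → Bool, (exp (G (Fin.cons true τ : Fin (m + 1) → Bool)) +
        exp (G (Fin.cons false τ : Fin (m + 1) → Bool))) / 2 ≤ exp (a ^ 2 / 8) * exp (H τ) := by
      intro τ
      have h1 := hG (Fin.cons false τ : Fin (m + 1) → Bool) 0 true
      rw [Fin.update_cons_zero] at h1
      set x := G (Fin.cons true τ : Fin (m + 1) → Bool)
      set y := G (Fin.cons false τ : Fin (m + 1) → Bool)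
      have e : (exp x + exp y) / 2 = cosh ((x - y) / 2) * exp ((x + y) / 2) := by
        rw [cosh_eq, div_mul_eq_mul_div, add_mul, ← exp_add, ← exp_add]
        ring_nf
      rw [e]
      gcongr
      refine (cosh_le_exp_half_sq _).trans (exp_le_exp.2 ?_)
      have := sq_le_sq' (abs_le.1 h1).1 (abs_le.1 h1).2
      linarith [this, show ((x - y) / 2) ^ 2 / 2 = (x - y) ^ 2 / 8 by ring]
    refine (signAvg_mono step).trans ?_
    rw [signAvg_const_mul]
    have hHd : ∀ σ i b, |H (Function.update σ i b) - H σ| ≤ a := by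
      intro σ i b
      have h1 := hG (Fin.cons true σ : Fin (m + 1) → Bool) i.succ b
      have h2 := hG (Fin.cons false σ : Fin (m + 1) → Bool) i.succ b
      rw [← Fin.cons_update] at h1 h2
      simp only [hH]
      rw [abs_le] at *
      constructor <;> linarith [h1.1, h1.2, h2.1, h2.2]
    calc _ ≤ exp (a ^ 2 / 8) * exp (signAvg H + m * a ^ 2 / 8) := by gcongr; exact ih H hHd
      _ = _ := by rw [← exp_add]; congr 1; push_cast; ring

/-- One coordinate of the contraction principle. -/
lemma ciSup_add_ciSup_sub_le {κ : Type*} [Finite κ] [Nonempty κ] (A u v : κ → ℝ)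
    (h : ∀ k k', |u k - u k'| ≤ |v k - v k'|) :
    (⨆ k, (A k + u k)) + (⨆ k, (A k - u k)) ≤ (⨆ k, (A k + v k)) + ⨆ k, (A k - v k) := by
  obtain ⟨p, hp⟩ := exists_eq_ciSup_of_finite (f := fun k => A k + u k)
  obtain ⟨q, hq⟩ := exists_eq_ciSup_of_finite (f := fun k => A k - u k)
  rw [← hp, ← hq]
  have l1 := fun k => le_ciSup (Set.finite_range fun k => A k + v k).bddAbove k
  have l2 := fun k => le_ciSup (Set.finite_range fun k => A k - v k).bddAbove k
  have := (le_abs_self _).trans (h p q)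
  rcases abs_cases (v p - v q) with ⟨e, -⟩ | ⟨e, -⟩
  · linarith [l1 p, l2 q]
  · linarith [l1 q, l2 p]

/-- The contraction principle for Rademacher averages. -/
lemma signAvg_contraction {κ : Type*} [Finite κ] [Nonempty κ] {m : ℕ} (A : κ → ℝ)
    (u v : Fin m → κ → ℝ) (h : ∀ i k k', |u i k - u i k'| ≤ |v i k - v i k'|) :
    signAvg (fun σ => ⨆ k, (A k + ∑ i, signOf (σ i) • u i k)) ≤
      signAvg (fun σ => ⨆ k, (A k + ∑ i, signOf (σ i) • v i k)) := by
  induction m generalizing A with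
  | zero => simp
  | succ m ih =>
    have key : ∀ w : Fin (m + 1) → κ → ℝ, signAvg (fun σ => ⨆ k, (A k + ∑ i, signOf (σ i) • w i k))
        = (1 / 2) * (signAvg (fun τ => ⨆ k, ((A k + w 0 k) + ∑ i, signOf (τ i) • w i.succ k)) +
          signAvg (fun τ => ⨆ k, ((A k - w 0 k) + ∑ i, signOf (τ i) • w i.succ k))) := by
      intro w
      rw [signAvg_succ, ← signAvg_add, ← signAvg_const_mul]
      congr 1
      funext τ
      have e (b : Bool) (k : κ) := sum_signOf_cons b τ (fun i => w i k)
      simp only [e, signOf_true, signOf_false, one_smul, neg_smul, add_assoc, sub_eq_add_neg]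
      ring
    rw [key u, key v]
    gcongr (1 / 2) * ?_
    calc _ ≤ signAvg (fun τ => ⨆ k, ((A k + v 0 k) + ∑ i, signOf (τ i) • u i.succ k)) +
          signAvg (fun τ => ⨆ k, ((A k - v 0 k) + ∑ i, signOf (τ i) • u i.succ k)) := by
          rw [← signAvg_add, ← signAvg_add]
          refine signAvg_mono fun τ => ?_
          have := ciSup_add_ciSup_sub_le (fun k => A k + ∑ i, signOf (τ i) • u i.succ k)
            (u 0) (v 0) (h 0)
          simpa only [add_right_comm, add_sub_right_comm] using this
      _ ≤ _ := add_le_add (ih _ _ _ fun i => h i.succ) (ih _ _ _ fun i => h i.succ)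

lemma signAvg_norm_sq {E : Type*} [NormedAddCommGroup E] [InnerProductSpace ℝ E] {m : ℕ}
    (w : E) (v : Fin m → E) :
    signAvg (fun σ => ‖w + ∑ i, signOf (σ i) • v i‖ ^ 2) = ‖w‖ ^ 2 + ∑ i, ‖v i‖ ^ 2 := by
  induction m generalizing w with
  | zero => simp [signAvg_const]
  | succ m ih =>
    rw [signAvg_succ]
    simp only [sum_signOf_cons, signOf_true, signOf_false, one_smul, neg_smul, ← add_assoc,
      add_div]
    rw [signAvg_add]
    simp only [div_eq_inv_mul]
    rw [signAvg_const_mul, signAvg_const_mul, ih, ih, Fin.sum_univ_succ]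
    have := parallelogram_law_with_norm ℝ w (v 0)
    rw [sub_eq_add_neg] at this
    linarith

lemma signAvg_norm_le {E : Type*} [NormedAddCommGroup E] [InnerProductSpace ℝ E] {m : ℕ}
    (v : Fin m → E) {r : ℝ} (hr : 0 ≤ r) (hv : ∀ i, ‖v i‖ ≤ r) :
    signAvg (fun σ => ‖∑ i, signOf (σ i) • v i‖) ≤ r * √m := by
  rcases Nat.eq_zero_or_pos m with rfl | hm
  · simp [signAvg_const]
  rcases hr.eq_or_lt with rfl | hr
  · have : v = 0 := funext fun i => norm_le_zero_iff.1 (hv i)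
    simp [this, signAvg_const]
  have hm' : (0 : ℝ) < √m := by positivity
  have hD : 0 < r * √m := by positivity
  set D := r * √m
  have h1 : ∀ σ : Fin m → Bool, ‖∑ i, signOf (σ i) • v i‖ ≤
      (2 * D)⁻¹ * ‖∑ i, signOf (σ i) • v i‖ ^ 2 + D / 2 := by
    intro σ
    set x := ‖∑ i, signOf (σ i) • v i‖
    have : (2 * D)⁻¹ * x ^ 2 + D / 2 - x = (x - D) ^ 2 / (2 * D) := by field_simp; ring
    have : 0 ≤ (x - D) ^ 2 / (2 * D) := by positivity
    linarith
  have h2 := signAvg_norm_sq 0 v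
  simp only [zero_add, norm_zero] at h2
  refine (signAvg_mono h1).trans ?_
  rw [signAvg_add, signAvg_const_mul, signAvg_const, h2]
  have h3 : ∑ i, ‖v i‖ ^ 2 ≤ D ^ 2 := by
    calc ∑ i, ‖v i‖ ^ 2 ≤ ∑ _i : Fin m, r ^ 2 := by gcongr; exact hv _
      _ = D ^ 2 := by simp [D, mul_pow, mul_comm]
  calc _ ≤ (2 * D)⁻¹ * D ^ 2 + D / 2 := by gcongr; simpa using h3
    _ = D := by field_simp; ring

/-- Rademacher complexity of Lipschitz functions of a bounded linear class. -/
lemma signAvg_ciSup_lipschitz_inner_le {E : Type*} [NormedAddCommGroup E] [InnerProductSpace ℝ E]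
    {κ : Type*} [Finite κ] [Nonempty κ] {m : ℕ} (θ : κ → E) (v : Fin m → E) {B r L : ℝ}
    (hB : 0 ≤ B) (hr : 0 ≤ r) (hL : 0 ≤ L) (hθ : ∀ k, ‖θ k‖ ≤ B) (hv : ∀ i, ‖v i‖ ≤ r)
    (u : Fin m → κ → ℝ)
    (hu : ∀ i k k', |u i k - u i k'| ≤ L * |inner ℝ (θ k) (v i) - inner ℝ (θ k') (v i)|) :
    signAvg (fun σ => ⨆ k, ∑ i, signOf (σ i) * u i k) ≤ L * B * r * √m := by
  have h := signAvg_contraction (fun _ => 0) u (fun i k => L * inner ℝ (θ k) (v i))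
    (fun i k k' => by rw [← mul_sub, abs_mul, abs_of_nonneg hL]; exact hu i k k')
  simp only [zero_add, smul_eq_mul] at h
  refine h.trans ?_
  have h2 : ∀ σ : Fin m → Bool, ⨆ k, ∑ i, signOf (σ i) * (L * inner ℝ (θ k) (v i)) ≤
      (L * B) * ‖∑ i, signOf (σ i) • v i‖ := by
    intro σ
    refine ciSup_le fun k => ?_
    have e : ∑ i, signOf (σ i) * (L * inner ℝ (θ k) (v i)) =
        L * inner ℝ (θ k) (∑ i, signOf (σ i) • v i) := by
      rw [inner_sum, Finset.mul_sum]
      refine Finset.sum_congr rfl fun i _ => ?_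
      rw [real_inner_smul_right]
      ring
    rw [e, mul_assoc]
    gcongr
    exact (real_inner_le_norm _ _).trans (by gcongr; exact hθ k)
  refine (signAvg_mono h2).trans ?_
  rw [signAvg_const_mul, mul_assoc (L * B)]
  gcongr
  exact signAvg_norm_le v hr hv

section Symmetrization

variable {Z κ : Type*} [Finite κ] [Nonempty κ] {m : ℕ}

/-- The exponential moment of a symmetrized empirical process given the double sample. -/
lemma signAvg_exp_ciSup_sub_le (g : κ → Z → ℝ) {c ρ t : ℝ} (ht : 0 ≤ t)
    (hg : ∀ k z, g k z ∈ Set.Icc 0 c)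
    (hρ : ∀ z : Fin m → Z, signAvg (fun σ => ⨆ k, ∑ i, signOf (σ i) * g k (z i)) ≤ ρ)
    (z z' : Fin m → Z) :
    signAvg (fun σ => exp (t * ⨆ k, ∑ i, signOf (σ i) * (g k (z' i) - g k (z i)))) ≤
      exp (2 * t * ρ + t ^ 2 * c ^ 2 * m / 2) := by
  have hd : ∀ k i, |g k (z' i) - g k (z i)| ≤ c := fun k i => by
    have h1 := hg k (z' i)
    have h2 := hg k (z i)
    rw [Set.mem_Icc] at h1 h2
    rw [abs_le]
    constructor <;> linarith
  have h1 := signAvg_exp_le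
    (fun σ : Fin m → Bool => t * ⨆ k, ∑ i, signOf (σ i) * (g k (z' i) - g k (z i)))
    (t * (2 * c)) (by
      intro σ i b
      rw [← mul_sub, abs_mul, abs_of_nonneg ht]
      gcongr
      refine abs_ciSup_sub_ciSup_le fun k => ?_
      rw [← Finset.sum_sub_distrib, Finset.sum_eq_single i]
      · rw [← sub_mul, abs_mul]
        have := abs_sub (signOf (Function.update σ i b i)) (signOf (σ i))
        rw [abs_signOf, abs_signOf] at this
        exact mul_le_mul (by linarith) (hd k i) (abs_nonneg _) (by norm_num)
      · intro j _ hj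
        rw [Function.update_of_ne hj, sub_self]
      · simp)
  refine h1.trans (exp_le_exp.2 ?_)
  rw [signAvg_const_mul]
  have h2 : signAvg (fun σ => ⨆ k, ∑ i, signOf (σ i) * (g k (z' i) - g k (z i))) ≤ ρ + ρ := by
    calc _ ≤ signAvg (fun σ => (⨆ k, ∑ i, signOf (σ i) * g k (z' i)) +
          (fun τ : Fin m → Bool => ⨆ k, ∑ i, signOf (τ i) * g k (z i)) fun i => !σ i) := by
          refine signAvg_mono fun σ => ciSup_le fun k => ?_
          have l1 := le_ciSup (Set.finite_range fun k => ∑ i, signOf (σ i) * g k (z' i)).bddAbove k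
          have l2 := le_ciSup
            (Set.finite_range fun k => ∑ i, signOf (!σ i) * g k (z i)).bddAbove k
          refine le_trans (le_of_eq ?_) (add_le_add l1 l2)
          rw [← Finset.sum_add_distrib]
          refine Finset.sum_congr rfl fun i _ => ?_
          rw [signOf_not]
          ring
      _ ≤ ρ + ρ := by
          rw [signAvg_add, signAvg_comp_not fun τ : Fin m → Bool =>
            ⨆ k, ∑ i, signOf (τ i) * g k (z i)]
          exact add_le_add (hρ z') (hρ z)
  calc _ ≤ t * (ρ + ρ) + m * (t * (2 * c)) ^ 2 / 8 := by gcongr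
    _ = _ := by ring

variable [MeasurableSpace Z] (P : Measure Z) [IsProbabilityMeasure P]

lemma integrable_exp_ciSup {W : Type*} [MeasurableSpace W] (μ : Measure W) [IsFiniteMeasure μ]
    (F : κ → W → ℝ) (hF : ∀ k, AEMeasurable (F k) μ) {C : ℝ} (hC : ∀ k w, |F k w| ≤ C) (t : ℝ) :
    Integrable (fun w => exp (t * ⨆ k, F k w)) μ := by
  have hmeas : AEMeasurable (fun w => exp (t * ⨆ k, F k w)) μ :=
    measurable_exp.comp_aemeasurable ((AEMeasurable.iSup hF).const_mul t)
  refine Integrable.of_bound hmeas.aestronglyMeasurable (exp (|t| * C)) (ae_of_all _ fun w => ?_)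
  rw [norm_eq_abs, abs_exp]
  refine exp_le_exp.2 ((le_abs_self _).trans ?_)
  rw [abs_mul]
  gcongr
  obtain ⟨k, hk⟩ := exists_eq_ciSup_of_finite (f := fun k => F k w)
  rw [← hk]
  exact hC k w

/-- Symmetrization of the double sample in exponential moment form. -/
lemma integral_exp_ciSup_double_sample_le (g : κ → Z → ℝ) {c ρ t : ℝ} (ht : 0 ≤ t)
    (hg : ∀ k z, g k z ∈ Set.Icc 0 c) (hgm : ∀ k, AEMeasurable (g k) P)
    (hρ : ∀ z : Fin m → Z, signAvg (fun σ => ⨆ k, ∑ i, signOf (σ i) * g k (z i)) ≤ ρ) :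
    ∫ w : Fin m → Z × Z, exp (t * ⨆ k, ∑ i, (g k (w i).2 - g k (w i).1))
      ∂(Measure.pi fun _ => P.prod P) ≤ exp (2 * t * ρ + t ^ 2 * c ^ 2 * m / 2) := by
  set ν : Measure (Fin m → Z × Z) := Measure.pi fun _ => P.prod P
  set ψ : (Fin m → Bool) → (Fin m → Z × Z) → ℝ := fun σ w =>
    exp (t * ⨆ k, ∑ i, signOf (σ i) * (g k (w i).2 - g k (w i).1)) with hψ
  have hd : ∀ k z z', |g k z' - g k z| ≤ c := fun k z z' => by
    have h1 := hg k z'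
    have h2 := hg k z
    rw [Set.mem_Icc] at h1 h2
    rw [abs_le]
    constructor <;> linarith
  have hint : ∀ σ, Integrable (ψ σ) ν := by
    intro σ
    refine integrable_exp_ciSup ν (fun k (w : Fin m → Z × Z) =>
      ∑ i, signOf (σ i) * (g k (w i).2 - g k (w i).1)) (fun k => ?_) (C := ∑ _i : Fin m, c)
      (fun k w => ?_) t
    · refine Finset.aemeasurable_fun_sum _ fun i _ => AEMeasurable.const_mul ?_ _
      have hi : Measure.QuasiMeasurePreserving (fun w : Fin m → Z × Z => w i) ν (P.prod P) :=
        (measurePreserving_eval (fun _ : Fin m => P.prod P) i).quasiMeasurePreserving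
      have h1 := (hgm k).comp_quasiMeasurePreserving
        (Measure.quasiMeasurePreserving_fst.comp hi)
      have h2 := (hgm k).comp_quasiMeasurePreserving
        (Measure.quasiMeasurePreserving_snd.comp hi)
      exact h2.sub h1
    · refine (Finset.abs_sum_le_sum_abs _ _).trans (Finset.sum_le_sum fun i _ => ?_)
      rw [abs_mul, abs_signOf, one_mul]
      exact hd _ _ _
  have hswap : ∀ σ, ∫ w, ψ σ w ∂ν = ∫ w, ψ (fun _ => true) w ∂ν := by
    intro σ
    have hT := measurePreserving_pi (fun _ : Fin m => P.prod P) (fun _ => P.prod P)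
      (f := fun i => if σ i then id else Prod.swap) (fun i => by
        cases σ i
        · simpa using Measure.measurePreserving_swap
        · simpa using MeasurePreserving.id _)
    have h := integral_map hT.measurable.aemeasurable
      (f := ψ fun _ => true) (by rw [hT.map_eq]; exact (hint _).aestronglyMeasurable)
    rw [hT.map_eq] at h
    rw [h]
    refine integral_congr_ae (ae_of_all _ fun w => ?_)
    simp only [hψ]
    congr 3
    funext k
    refine Finset.sum_congr rfl fun i _ => ?_
    cases σ i <;> simp
  have hone : ∫ w, exp (t * ⨆ k, ∑ i, (g k (w i).2 - g k (w i).1)) ∂ν =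
      ∫ w, ψ (fun _ => true) w ∂ν := by simp [hψ]
  rw [hone]
  calc ∫ w, ψ (fun _ => true) w ∂ν = signAvg (fun σ => ∫ w, ψ σ w ∂ν) := by
        simp only [hswap, signAvg_const]
    _ = ∫ w, signAvg (fun σ => ψ σ w) ∂ν := by
        simp only [signAvg]
        rw [integral_const_mul, integral_finsetSum _ fun σ _ => hint σ]
    _ ≤ ∫ _w, exp (2 * t * ρ + t ^ 2 * c ^ 2 * m / 2) ∂ν := by
        refine integral_mono ?_ (integrable_const _) fun w => ?_
        · simp only [signAvg]
          exact (integrable_finsetSum _ fun σ _ => hint σ).const_mul _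
        · exact signAvg_exp_ciSup_sub_le g ht hg hρ (fun i => (w i).1) (fun i => (w i).2)
    _ = _ := by simp

/-- Exponential moment bound for the supremum of an empirical process by Rademacher averages. -/
lemma mgf_ciSup_empirical_le (g : κ → Z → ℝ) {c ρ t : ℝ} (ht : 0 ≤ t)
    (hg : ∀ k z, g k z ∈ Set.Icc 0 c) (hgm : ∀ k, AEMeasurable (g k) P)
    (hρ : ∀ z : Fin m → Z, signAvg (fun σ => ⨆ k, ∑ i, signOf (σ i) * g k (z i)) ≤ ρ) :
    Integrable (fun S : Fin m → Z => exp (t * ⨆ k, ∑ i, ((∫ z, g k z ∂P) - g k (S i))))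
        (Measure.pi fun _ => P) ∧
      ∫ S : Fin m → Z, exp (t * ⨆ k, ∑ i, ((∫ z, g k z ∂P) - g k (S i)))
        ∂(Measure.pi fun _ => P) ≤ exp (2 * t * ρ + t ^ 2 * c ^ 2 * m / 2) := by
  set μ : Measure (Fin m → Z) := Measure.pi fun _ => P
  have hgi : ∀ k, Integrable (g k) P := fun k =>
    Integrable.of_bound (hgm k).aestronglyMeasurable c (ae_of_all _ fun z => by
      rw [norm_eq_abs, abs_of_nonneg (hg k z).1]; exact (hg k z).2)
  have hI : ∀ k, ∫ z, g k z ∂P ∈ Set.Icc 0 c := fun k =>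
    ⟨integral_nonneg fun z => (hg k z).1, by
      simpa using integral_mono (hgi k) (integrable_const c) fun z => (hg k z).2⟩
  have hdiff : ∀ x ∈ Set.Icc 0 c, ∀ y ∈ Set.Icc 0 c, |x - y| ≤ c := by
    intro x hx y hy
    rw [Set.mem_Icc] at hx hy
    rw [abs_le]
    constructor <;> linarith
  have hgS : ∀ k i, AEMeasurable (fun S : Fin m → Z => g k (S i)) μ := fun k i =>
    (hgm k).comp_quasiMeasurePreserving
      (measurePreserving_eval (fun _ : Fin m => P) i).quasiMeasurePreserving
  have hint1 : Integrable (fun S : Fin m → Z =>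
      exp (t * ⨆ k, ∑ i, ((∫ z, g k z ∂P) - g k (S i)))) μ := by
    refine integrable_exp_ciSup μ (fun k (S : Fin m → Z) => ∑ i, ((∫ z, g k z ∂P) - g k (S i)))
      (fun k => ?_) (C := ∑ _i : Fin m, c) (fun k w => ?_) t
    · exact Finset.aemeasurable_fun_sum _ fun i _ => (hgS k i).const_sub _
    · exact (Finset.abs_sum_le_sum_abs _ _).trans
        (Finset.sum_le_sum fun i _ => hdiff _ (hI k) _ (hg _ _))
  have hint2 : Integrable (fun p : (Fin m → Z) × (Fin m → Z) =>
      exp (t * ⨆ k, ∑ i, (g k (p.2 i) - g k (p.1 i)))) (μ.prod μ) := by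
    refine integrable_exp_ciSup (μ.prod μ) (fun k (p : (Fin m → Z) × (Fin m → Z)) =>
      ∑ i, (g k (p.2 i) - g k (p.1 i)))
      (fun k => ?_) (C := ∑ _i : Fin m, c) (fun k w => ?_) t
    · refine Finset.aemeasurable_fun_sum _ fun i _ => ?_
      exact ((hgS k i).comp_quasiMeasurePreserving Measure.quasiMeasurePreserving_snd).sub
        ((hgS k i).comp_quasiMeasurePreserving Measure.quasiMeasurePreserving_fst)
    · exact (Finset.abs_sum_le_sum_abs _ _).trans
        (Finset.sum_le_sum fun i _ => hdiff _ (hg _ _) _ (hg _ _))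
  refine ⟨hint1, ?_⟩
  have hjensen : ∀ᵐ S ∂μ, exp (t * ⨆ k, ∑ i, ((∫ z, g k z ∂P) - g k (S i))) ≤
      ∫ S', exp (t * ⨆ k, ∑ i, (g k (S' i) - g k (S i))) ∂μ := by
    filter_upwards [hint2.prod_right_ae] with S hS
    obtain ⟨k, hk⟩ := exists_eq_ciSup_of_finite
      (f := fun k => ∑ i, ((∫ z, g k z ∂P) - g k (S i)))
    rw [← hk]
    have hgSi : ∀ i, Integrable (fun S' : Fin m → Z => g k (S' i)) μ := fun i =>
      integrable_comp_eval (μ := fun _ : Fin m => P) (hgi k)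
    have hX : Integrable (fun S' : Fin m → Z => t * ∑ i, (g k (S' i) - g k (S i))) μ :=
      (integrable_finsetSum _ fun i _ => (hgSi i).sub (integrable_const _)).const_mul t
    have hXe : ∫ S', t * ∑ i, (g k (S' i) - g k (S i)) ∂μ =
        t * ∑ i, ((∫ z, g k z ∂P) - g k (S i)) := by
      rw [integral_const_mul, integral_finsetSum Finset.univ
        (f := fun i (S' : Fin m → Z) => g k (S' i) - g k (S i)) fun i _ =>
        (hgSi i).sub (integrable_const (g k (S i)))]
      congr 1
      refine Finset.sum_congr rfl fun i _ => ?_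
      rw [integral_sub (hgSi i) (integrable_const _)]
      have := integral_comp_eval (μ := fun _ : Fin m => P) (i := i) (hgm k).aestronglyMeasurable
      simp [μ, this]
    have hXexp : Integrable (fun S' : Fin m → Z => exp (t * ∑ i, (g k (S' i) - g k (S i)))) μ := by
      simpa using integrable_exp_ciSup (κ := Unit) μ
        (fun _ (S' : Fin m → Z) => ∑ i, (g k (S' i) - g k (S i)))
        (fun _ => Finset.aemeasurable_fun_sum _ fun i _ => (hgS k i).sub_const _)
        (C := ∑ _i : Fin m, c) (fun _ w => (Finset.abs_sum_le_sum_abs _ _).trans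
          (Finset.sum_le_sum fun i _ => hdiff _ (hg _ _) _ (hg _ _))) t
    calc exp (t * ∑ i, ((∫ z, g k z ∂P) - g k (S i)))
        ≤ ∫ S', exp (t * ∑ i, (g k (S' i) - g k (S i))) ∂μ := by
          rw [← hXe]
          exact convexOn_exp.map_integral_le continuous_exp.continuousOn isClosed_univ
            (by simp) hX hXexp
      _ ≤ _ := by
          refine integral_mono hXexp hS fun S' => exp_le_exp.2 ?_
          gcongr
          exact le_ciSup (f := fun k => ∑ i, (g k (S' i) - g k (S i)))
            (Set.finite_range _).bddAbove k
  calc _ ≤ ∫ S, ∫ S', exp (t * ⨆ k, ∑ i, (g k (S' i) - g k (S i))) ∂μ ∂μ :=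
        integral_mono_ae hint1 hint2.integral_prod_left hjensen
    _ = ∫ p, exp (t * ⨆ k, ∑ i, (g k (p.2 i) - g k (p.1 i))) ∂(μ.prod μ) :=
        (integral_prod _ hint2).symm
    _ = ∫ w : Fin m → Z × Z, exp (t * ⨆ k, ∑ i, (g k (w i).2 - g k (w i).1))
        ∂(Measure.pi fun _ => P.prod P) :=
        ((measurePreserving_arrowProdEquivProdArrow Z Z (Fin m) (fun _ => P)
          (fun _ => P)).integral_comp' _).symm
    _ ≤ _ := integral_exp_ciSup_double_sample_le P g ht hg hgm hρ

/-- One-sided deviation bound for the supremum of an empirical process by Rademacher averages. -/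
lemma measureReal_ciSup_empirical_ge_le (g : κ → Z → ℝ) {c ρ s : ℝ} (hc : 0 < c) (hs : 0 ≤ s)
    (hm : 1 ≤ m) (hg : ∀ k z, g k z ∈ Set.Icc 0 c) (hgm : ∀ k, AEMeasurable (g k) P)
    (hρ : ∀ z : Fin m → Z, signAvg (fun σ => ⨆ k, ∑ i, signOf (σ i) * g k (z i)) ≤ ρ) :
    (Measure.pi fun _ : Fin m => P).real
        {S | 2 * ρ + s ≤ ⨆ k, ∑ i, ((∫ z, g k z ∂P) - g k (S i))} ≤
      exp (-(s ^ 2 / (2 * m * c ^ 2))) := by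
  have hm' : (0 : ℝ) < m := by exact_mod_cast hm
  have ht : 0 ≤ s / (m * c ^ 2) := by positivity
  obtain ⟨h1, h2⟩ := mgf_ciSup_empirical_le P g ht hg hgm hρ
  refine (ProbabilityTheory.measure_ge_le_exp_mul_mgf _ ht h1).trans ?_
  calc _ ≤ exp (-(s / (m * c ^ 2)) * (2 * ρ + s)) *
        exp (2 * (s / (m * c ^ 2)) * ρ + (s / (m * c ^ 2)) ^ 2 * c ^ 2 * m / 2) := by
        gcongr
        exact h2
    _ = _ := by
        rw [← exp_add]
        congr 1
        field_simp
        ring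

end Symmetrization

/-- Uniform deviation bound for Lipschitz losses over a bounded linear class. The loss is not
assumed measurable: where it is not, the Bochner integral vanishes and the bound is trivial. -/
lemma uniform_deviation_linear_class {X E : Type*} [MeasurableSpace X] [NormedAddCommGroup E]
    [InnerProductSpace ℝ E] [FiniteDimensional ℝ E] (φ : X → E) {r B c L δ : ℝ} (hr : 0 < r)
    (hφ : ∀ x, ‖φ x‖ ≤ r) (hB : 0 < B) (hc : 0 < c) (hL : 0 < L) (ℓ : ℝ → ℝ → ℝ)
    (hℓbdd : ∀ y z, ℓ y z ∈ Set.Icc 0 c)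
    (hℓlip : ∀ y : ℝ, LipschitzWith (Real.toNNReal L) fun z => ℓ y z)
    (hδ : δ ∈ Set.Ioo (0 : ℝ) 1) {m : ℕ} (hm : 1 ≤ m)
    (P : Measure (X × ℝ)) [IsProbabilityMeasure P] :
    ENNReal.ofReal (1 - δ) ≤ (Measure.pi fun _ : Fin m => P)
      {S | ∀ θ : E, ‖θ‖ ≤ B →
        ∫ p, ℓ p.2 (inner ℝ θ (φ p.1)) ∂P -
            (1 / (m : ℝ)) * ∑ i, ℓ (S i).2 (inner ℝ θ (φ (S i).1)) ≤
          2 * L * (B * (r + 1) / √m) + 3 * c * √(log (2 / δ) / (2 * m))} := by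
  obtain ⟨hδ0, hδ1⟩ := hδ
  set μ : Measure (Fin m → X × ℝ) := Measure.pi fun _ => P
  have hm' : (0 : ℝ) < m := by exact_mod_cast hm
  have hsm : (0 : ℝ) < √m := by positivity
  have hlog : 0 < log (2 / δ) := log_pos (by rw [lt_div_iff₀ hδ0]; linarith)
  set g : E → X × ℝ → ℝ := fun θ p => ℓ p.2 (inner ℝ θ (φ p.1))
  set s := √(log (2 / δ) / (2 * m))
  have hs2 : s ^ 2 = log (2 / δ) / (2 * m) := sq_sqrt (by positivity)
  have hlip : ∀ y z z', |ℓ y z - ℓ y z'| ≤ L * |z - z'| := fun y z z' => by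
    simpa [Real.dist_eq, hL.le] using (hℓlip y).dist_le_mul z z'
  set G : Set E := {θ | ‖θ‖ ≤ B ∧ AEMeasurable (g θ) P}
  have hGbdd : Bornology.IsBounded G :=
    (Metric.isBounded_closedBall (x := (0 : E)) (r := B)).subset fun θ hθ => by
      simpa using hθ.1
  obtain ⟨T, hTG, hTfin, hcover⟩ := exists_finite_cover_balls_of_isCompact_closure
    hGbdd.isCompact_closure (ε := B / (√m * r)) (by positivity)
  have hnonmeas : ∀ θ, ¬ AEMeasurable (g θ) P → ∀ S : Fin m → X × ℝ,
      ∫ p, g θ p ∂P - (1 / (m : ℝ)) * ∑ i, g θ (S i) ≤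
        2 * L * (B * (r + 1) / √m) + 3 * c * s := by
    intro θ hθ S
    rw [integral_non_aestronglyMeasurable fun h => hθ h.aemeasurable]
    have h1 : 0 ≤ (1 / (m : ℝ)) * ∑ i, g θ (S i) :=
      mul_nonneg (by positivity) (Finset.sum_nonneg fun i _ => (hℓbdd _ _).1)
    have h2 : 0 ≤ 2 * L * (B * (r + 1) / √m) + 3 * c * s := by positivity
    linarith
  rcases T.eq_empty_or_nonempty with rfl | hTne
  · have huniv : {S : Fin m → X × ℝ | ∀ θ : E, ‖θ‖ ≤ B →
        ∫ p, g θ p ∂P - (1 / (m : ℝ)) * ∑ i, g θ (S i) ≤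
          2 * L * (B * (r + 1) / √m) + 3 * c * s} = Set.univ := by
      refine Set.eq_univ_of_forall fun S θ hθ => hnonmeas θ (fun h => ?_) S
      simpa using hcover (show θ ∈ G from ⟨hθ, h⟩)
    rw [huniv, measure_univ]
    exact ENNReal.ofReal_le_one.2 (by linarith)
  have : Finite T := hTfin
  have : Nonempty T := hTne.to_subtype
  set ρ := L * B * r * √m
  have hbad := measureReal_ciSup_empirical_ge_le P (fun k : T => g k) (ρ := ρ) (s := m * (3 * c * s))
    hc (by positivity) hm (fun k z => hℓbdd _ _) (fun k => (hTG k.2).2) (fun z =>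
      signAvg_ciSup_lipschitz_inner_le (fun k : T => (k : E)) (fun i => φ (z i).1) hB.le hr.le hL.le
        (fun k => (hTG k.2).1) (fun i => hφ _) (fun i k => g k (z i)) fun i k k' => hlip _ _ _)
  set bad : Set (Fin m → X × ℝ) :=
    {S | 2 * ρ + m * (3 * c * s) ≤ ⨆ k : T, ∑ i, ((∫ z, g k z ∂P) - g k (S i))}
  have hexp : exp (-((m * (3 * c * s)) ^ 2 / (2 * m * c ^ 2))) ≤ δ := by
    have e : (m * (3 * c * s)) ^ 2 / (2 * m * c ^ 2) = 9 / 4 * log (2 / δ) := by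
      rw [mul_pow, mul_pow, hs2]
      field_simp
      norm_num
    calc _ ≤ exp (-log (2 / δ)) := by
          rw [e]
          exact exp_le_exp.2 (by linarith)
      _ = δ / 2 := by
          rw [exp_neg, exp_log (by positivity), inv_div]
      _ ≤ δ := by linarith
  have hbad' : μ bad ≤ ENNReal.ofReal δ := by
    rw [← ofReal_measureReal]
    exact ENNReal.ofReal_le_ofReal (hbad.trans hexp)
  set good : Set (Fin m → X × ℝ) := {S | ∀ θ : E, ‖θ‖ ≤ B →
    ∫ p, g θ p ∂P - (1 / (m : ℝ)) * ∑ i, g θ (S i) ≤ 2 * L * (B * (r + 1) / √m) + 3 * c * s}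
  have hsub : badᶜ ⊆ good := by
    intro S hS θ hθ
    by_cases hmeas : AEMeasurable (g θ) P
    swap
    · exact hnonmeas θ hmeas S
    obtain ⟨k, hkT, hk⟩ := Set.mem_iUnion₂.1 (hcover (show θ ∈ G from ⟨hθ, hmeas⟩))
    rw [Metric.mem_ball, dist_eq_norm] at hk
    set η := L * B / √m
    have hclose : ∀ p, |g θ p - g k p| ≤ η := by
      intro p
      refine (hlip _ _ _).trans ?_
      rw [← inner_sub_left]
      calc L * |inner ℝ (θ - k) (φ p.1)| ≤ L * (B / (√m * r) * r) := by
            gcongr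
            exact (abs_real_inner_le_norm _ _).trans (mul_le_mul hk.le (hφ _) (norm_nonneg _)
              (by positivity))
        _ = η := by simp only [η]; field_simp
    have hint : ∀ θ', AEMeasurable (g θ') P → Integrable (g θ') P := fun θ' h =>
      Integrable.of_bound h.aestronglyMeasurable c (ae_of_all _ fun z => by
        rw [norm_eq_abs, abs_of_nonneg (hℓbdd _ _).1]; exact (hℓbdd _ _).2)
    have hintk := hint k (hTG hkT).2
    have hI : ∫ p, g θ p ∂P ≤ ∫ p, g k p ∂P + η := by
      have := integral_mono (hint θ hmeas) (hintk.add (integrable_const η)) fun p => by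
        have := (abs_le.1 (hclose p)).2
        simp only [Pi.add_apply]
        linarith
      simpa [integral_add hintk (integrable_const η)] using this
    have hlt : ∑ i, ((∫ z, g k z ∂P) - g k (S i)) < 2 * ρ + m * (3 * c * s) :=
      lt_of_le_of_lt (le_ciSup (f := fun k : T => ∑ i, ((∫ z, g k z ∂P) - g k (S i)))
        (Set.finite_range _).bddAbove ⟨k, hkT⟩) (not_le.1 hS)
    have hsum : ∑ i, ((∫ z, g θ z ∂P) - g θ (S i)) ≤
        ∑ i, (((∫ z, g k z ∂P) - g k (S i)) + 2 * η) :=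
      Finset.sum_le_sum fun i _ => by linarith [(abs_le.1 (hclose (S i))).1]
    rw [Finset.sum_sub_distrib, Finset.sum_add_distrib] at hsum
    simp only [Finset.sum_const, Finset.card_univ, Fintype.card_fin, nsmul_eq_mul] at hsum
    have hfin : m * (∫ p, g θ p ∂P - (1 / (m : ℝ)) * ∑ i, g θ (S i)) ≤
        m * (2 * L * (B * (r + 1) / √m) + 3 * c * s) := by
      have e1 : m * (∫ p, g θ p ∂P - (1 / (m : ℝ)) * ∑ i, g θ (S i)) =
          m * ∫ p, g θ p ∂P - ∑ i, g θ (S i) := by field_simp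
      have e2 : m * (2 * L * (B * (r + 1) / √m) + 3 * c * s) =
          2 * ρ + m * (3 * c * s) + m * (2 * η) := by
        have : (m : ℝ) = √m * √m := (mul_self_sqrt hm'.le).symm
        simp only [ρ, η]
        field_simp
        linear_combination (2 * L * B * r) * this
      rw [e1, e2]
      linarith
    exact le_of_mul_le_mul_left hfin hm'
  rw [ENNReal.ofReal_sub _ hδ0.le, ENNReal.ofReal_one, tsub_le_iff_right]
  calc (1 : ℝ≥0∞) = μ (badᶜ ∪ bad) := by rw [Set.compl_union_self, measure_univ]
    _ ≤ μ badᶜ + μ bad := measure_union_le _ _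
    _ ≤ μ good + ENNReal.ofReal δ := add_le_add (measure_mono hsub) hbad'

section Features

variable {d : ℕ} (Ωp : Finset (Fin d → ℝ))

/-- The feature vector `(1/2, (cos(ω·x))_ω, (sin(ω·x))_ω)`. -/
noncomputable def trigFeature (x : Fin d → ℝ) : EuclideanSpace ℝ (Option (Ωp × Bool)) :=
  WithLp.toLp 2 fun o => o.elim (1 / 2) fun p =>
    if p.2 then cos (dot (p.1 : Fin d → ℝ) x) else sin (dot (p.1 : Fin d → ℝ) x)

/-- The coefficient vector `(a₀, (a_ω)_ω, (b_ω)_ω)`. -/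
noncomputable def coeffVector (a0 : ℝ) (a b : (Fin d → ℝ) → ℝ) :
    EuclideanSpace ℝ (Option (Ωp × Bool)) :=
  WithLp.toLp 2 fun o => o.elim a0 fun p => if p.2 then a p.1 else b p.1

lemma norm_trigFeature (x : Fin d → ℝ) : ‖trigFeature Ωp x‖ = √(1 / 4 + Ωp.card) := by
  rw [EuclideanSpace.norm_eq]
  congr 1
  simp only [trigFeature, Fintype.sum_option, Fintype.sum_prod_type, Fintype.sum_bool, norm_eq_abs,
    sq_abs, Option.elim, if_true, Bool.false_eq_true, if_false, cos_sq_add_sin_sq]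
  simp
  norm_num

lemma norm_coeffVector (a0 : ℝ) (a b : (Fin d → ℝ) → ℝ) :
    ‖coeffVector Ωp a0 a b‖ = coeffNorm2 Ωp a0 a b := by
  rw [EuclideanSpace.norm_eq, coeffNorm2]
  congr 1
  simp only [coeffVector, Fintype.sum_option, Fintype.sum_prod_type, Fintype.sum_bool, norm_eq_abs,
    sq_abs, Option.elim, if_true, Bool.false_eq_true, if_false]
  rw [Finset.sum_coe_sort Ωp fun ω => a ω ^ 2 + b ω ^ 2]

lemma gtp_eq_inner (a0 : ℝ) (a b : (Fin d → ℝ) → ℝ) (x : Fin d → ℝ) :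
    gtp Ωp a0 a b x = inner ℝ (coeffVector Ωp a0 a b) (trigFeature Ωp x) := by
  rw [PiLp.inner_apply, gtp, ← Finset.sum_coe_sort Ωp]
  simp only [coeffVector, trigFeature, Fintype.sum_option, Fintype.sum_prod_type, Fintype.sum_bool,
    Option.elim, if_true, Bool.false_eq_true, if_false, RCLike.inner_apply, conj_trivial]
  congr 1
  · ring
  · exact Finset.sum_congr rfl fun ω _ => by ring

end Features

lemma complexity_le_min {d n m : ℕ} (hd : 1 ≤ d) (hn : 1 ≤ n) {B : ℝ} (K : ℝ) (hB : 0 < B) :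
    B * (√(1 / 4 + n) + 1) / √m ≤
      min ((1 / √m) * (2 * π * max K (B * √n) * √(2 * log (2 * d)) + max π B))
        (B / √m + 2 * B * √(2 * (2 * n + 1) * log (2 * n + 1)) / √m) := by
  have hd' : (1 : ℝ) ≤ d := by exact_mod_cast hd
  have hn' : (1 : ℝ) ≤ n := by exact_mod_cast hn
  have hlog2 := log_two_gt_d9
  have hr : √(1 / 4 + n) ≤ 2 * √n := by
    rw [show (2 : ℝ) * √n = √(4 * n) by
      rw [sqrt_mul (by norm_num), show (4 : ℝ) = 2 ^ 2 by norm_num, sqrt_sq (by norm_num)]]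
    exact sqrt_le_sqrt (by linarith)
  have hBn : 0 ≤ B * √n := by positivity
  refine le_min ?_ ?_
  · have h1 : 1 ≤ √(2 * log (2 * d)) := by
      rw [one_le_sqrt]
      have := log_le_log (by norm_num) (show (2 : ℝ) ≤ 2 * d by linarith)
      linarith
    have h2 : 2 * (B * √n) ≤ 2 * π * max K (B * √n) * √(2 * log (2 * d)) := by
      calc 2 * (B * √n) = 2 * 1 * (B * √n) * 1 := by ring
        _ ≤ _ := by
          gcongr
          · linarith [pi_gt_three]
          · exact le_max_right _ _
    have h3 : B * √(1 / 4 + n) ≤ B * (2 * √n) := by gcongr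
    rw [one_div_mul_eq_div]
    gcongr
    linarith [le_max_right π B]
  · rw [← add_div]
    gcongr
    have h1 : √(n : ℝ) ≤ √(2 * (2 * n + 1) * log (2 * n + 1)) := by
      refine sqrt_le_sqrt ?_
      have := log_le_log (by norm_num) (show (2 : ℝ) ≤ 2 * n + 1 by linarith)
      nlinarith
    have h3 : B * √(1 / 4 + n) ≤ B * (2 * √(2 * (2 * n + 1) * log (2 * n + 1))) := by
      gcongr
      linarith
    linarith

/-- Uniform generalization bound for `H_Ω^{B̃}` via the combined
Rademacher complexity bound: with probability at least `1 − δ` over an i.i.d. sample of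
size `m` from `P`, every `f ∈ H_Ω^{B̃}` satisfies
`R(f) − R̂_S(f) ≤ 2L·min{…, …} + 3c·√(log(2/δ)/(2m))`. -/
theorem generalization_bound_gtp_rademacher
    (d : ℕ) (hd : 1 ≤ d) (Ωp : Finset (Fin d → ℝ)) (hne : Ωp.Nonempty)
    (hzero : ∀ ω ∈ Ωp, ω ≠ 0) (hasym : ∀ ω ∈ Ωp, -ω ∉ Ωp)
    (Bt : ℝ) (hBt : 0 < Bt)
    (c L : ℝ) (hc : 0 < c) (hL : 0 < L)
    (ℓ : ℝ → ℝ → ℝ) (hℓbdd : ∀ y z, ℓ y z ∈ Set.Icc 0 c)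
    (hℓlip : ∀ y : ℝ, LipschitzWith (Real.toNNReal L) fun z => ℓ y z)
    (δ : ℝ) (hδ : δ ∈ Set.Ioo (0 : ℝ) 1)
    (m : ℕ) (hm : 1 ≤ m)
    (P : Measure ((Fin d → ℝ) × ℝ)) [IsProbabilityMeasure P]
    (hP : P {p | p.1 ∈ box d} = 1) :
    ENNReal.ofReal (1 - δ) ≤
      (Measure.pi fun _ : Fin m => P)
        {S | ∀ f ∈ Hclass Ωp Bt,
          risk P ℓ f - empRisk ℓ S f ≤
            2 * L *
                min
                  ((1 / Real.sqrt m) *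
                    (2 * π * max (Kconst Ωp hne) (Bt * Real.sqrt Ωp.card) *
                        Real.sqrt (2 * Real.log (2 * d)) +
                      max π Bt))
                  (Bt / Real.sqrt m +
                    2 * Bt *
                      Real.sqrt (2 * (2 * Ωp.card + 1) * Real.log (2 * Ωp.card + 1)) /
                        Real.sqrt m) +
              3 * c * Real.sqrt (Real.log (2 / δ) / (2 * m))} := by
  have hn : 1 ≤ Ωp.card := hne.card_pos
  refine (uniform_deviation_linear_class (trigFeature Ωp) (r := √(1 / 4 + Ωp.card)) (by positivity)
    (fun x => (norm_trigFeature Ωp x).le) hBt hc hL ℓ hℓbdd hℓlip hδ hm P).trans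
    (measure_mono ?_)
  rintro S hS f ⟨a0, a, b, hab, rfl⟩
  have h := hS (coeffVector Ωp a0 a b) ((norm_coeffVector Ωp a0 a b).trans_le hab)
  simp only [← gtp_eq_inner] at h
  refine h.trans ?_
  gcongr
  exact complexity_le_min hd hn _ hBt
end

section
/- There exists a universal constant C > 0 with the following property. Let B > 0, let F be the set of all generalized trigonometric polynomials f with frequencies in Ω₊ satisfying sup_x |f(x)| ≤ B, and let B̃ ≥ 1 be such that F ⊆ H_Ω^{B̃}. Then for every ε, δ ∈ (0,1) and every probability measure P on [0,2π)^d × ℝ: if m ≥ C·ε^{−2}·( B²·L²·|Ω|·( log(|Ω|) + log(3·B̃) ) + c²·log(1/δ) ), then the m-fold product measure P^m gives probability at least 1 − δ to the set of samples S of size m such that R(f) − R̂_S(f) ≤ ε holds for every f ∈ F. -/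
open Real MeasureTheory
open scoped ENNReal NNReal BigOperators

/-- The class `F` of generalized trigonometric polynomials with frequencies in `Ω₊`
that are bounded in absolute value by `B` on the box `[0, 2π)^d`. -/
noncomputable def FclassSup {d : ℕ} (Ωp : Finset (Fin d → ℝ)) (B : ℝ) :
    Set ((Fin d → ℝ) → ℝ) :=
  { f | (∃ a0 a b, f = gtp Ωp a0 a b) ∧ ∀ x ∈ box d, |f x| ≤ B }

section PackingBound
open Metric Module
variable {E : Type*} [NormedAddCommGroup E] [NormedSpace ℝ E] [FiniteDimensional ℝ E]

/-- Volume bound on the cardinality of a separated subset of a ball. -/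
theorem card_le_of_separated_of_norm_le {B t : ℝ} (hB : 0 ≤ B) (ht : 0 < t) (s : Finset E)
    (hs : ∀ c ∈ s, ‖c‖ ≤ B) (h : ∀ c ∈ s, ∀ d ∈ s, c ≠ d → t ≤ ‖c - d‖) :
    (s.card : ℝ) ≤ (1 + 2 * B / t) ^ finrank ℝ E := by
  borelize E
  let μ : Measure E := Measure.addHaar
  have hδ : 0 < t / 2 := by positivity
  have hρ : 0 < B + t / 2 := by positivity
  have hdisj : Set.Pairwise (s : Set E) (Function.onFun Disjoint fun c => ball c (t / 2)) := by
    rintro c hc d hd hcd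
    apply ball_disjoint_ball
    rw [dist_eq_norm]
    simpa using h c hc d hd hcd
  have hsub : (⋃ c ∈ s, ball c (t / 2)) ⊆ ball (0 : E) (B + t / 2) := by
    refine Set.iUnion₂_subset fun x hx => ball_subset_ball' ?_
    rw [dist_zero_right]
    linarith [hs x hx]
  have hvol : (s.card : ℝ≥0∞) * ENNReal.ofReal ((t / 2) ^ finrank ℝ E) * μ (ball 0 1) ≤
      ENNReal.ofReal ((B + t / 2) ^ finrank ℝ E) * μ (ball 0 1) := by
    calc
      _ = μ (⋃ c ∈ s, ball c (t / 2)) := by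
        rw [measure_biUnion_finset hdisj fun c _ => measurableSet_ball]
        simp only [μ.addHaar_ball_of_pos _ hδ, Finset.sum_const, nsmul_eq_mul, mul_assoc]
      _ ≤ μ (ball (0 : E) (B + t / 2)) := measure_mono hsub
      _ = _ := by simp only [μ.addHaar_ball_of_pos _ hρ]
  have hcard := (ENNReal.mul_le_mul_iff_left (measure_ball_pos _ _ zero_lt_one).ne'
    measure_ball_lt_top.ne).1 hvol
  have hreal := ENNReal.toReal_le_of_le_ofReal (pow_nonneg hρ.le _) hcard
  rw [ENNReal.toReal_mul, ENNReal.toReal_natCast, ENNReal.toReal_ofReal (by positivity),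
    ← le_div_iff₀ (by positivity), ← div_pow] at hreal
  rwa [show 1 + 2 * B / t = (B + t / 2) / (t / 2) by field_simp; ring]

/-- A subset of a ball has an internal finite net of controlled cardinality. -/
theorem exists_finset_net {B t : ℝ} (hB : 0 ≤ B) (ht : 0 < t) {K : Set E}
    (hK : ∀ v ∈ K, ‖v‖ ≤ B) :
    ∃ s : Finset E, (∀ u ∈ s, u ∈ K) ∧ (∀ v ∈ K, ∃ u ∈ s, ‖v - u‖ ≤ t) ∧
      (s.card : ℝ) ≤ (1 + 2 * B / t) ^ finrank ℝ E := by
  classical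
  let A : Set ℕ := {n | ∃ s : Finset E, (∀ u ∈ s, u ∈ K) ∧
    (∀ u ∈ s, ∀ v ∈ s, u ≠ v → t ≤ ‖u - v‖) ∧ s.card = n}
  have hcard (s : Finset E) (hs : ∀ u ∈ s, u ∈ K)
      (hsep : ∀ u ∈ s, ∀ v ∈ s, u ≠ v → t ≤ ‖u - v‖) :
      (s.card : ℝ) ≤ (1 + 2 * B / t) ^ finrank ℝ E :=
    card_le_of_separated_of_norm_le hB ht s (fun c hc => hK c (hs c hc)) hsep
  have hbdd : BddAbove A := by
    refine ⟨⌊(1 + 2 * B / t) ^ finrank ℝ E⌋₊, ?_⟩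
    rintro _ ⟨s, hs, hsep, rfl⟩
    exact Nat.le_floor (hcard s hs hsep)
  obtain ⟨s, hs, hsep, hmax⟩ := Nat.sSup_mem (s := A) ⟨0, ∅, by simp⟩ hbdd
  refine ⟨s, hs, fun v hv => ?_, hcard s hs hsep⟩
  by_contra! hfar
  have hvs : v ∉ s := fun hmem => by
    have := hfar v hmem
    simp at this
    linarith
  have hle : (insert v s).card ≤ sSup A := by
    refine le_csSup hbdd ⟨insert v s, ?_, ?_, rfl⟩
    · intro u hu
      rcases Finset.mem_insert.1 hu with rfl | hu
      exacts [hv, hs u hu]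
    · intro u hu w hw huw
      rcases Finset.mem_insert.1 hu with hu | hu <;> rcases Finset.mem_insert.1 hw with hw | hw
      · exact absurd (hu.trans hw.symm) huw
      · exact hu ▸ (hfar w hw).le
      · rw [norm_sub_rev]; exact hw ▸ (hfar u hu).le
      · exact hsep u hu w hw huw
  rw [Finset.card_insert_of_notMem hvs] at hle
  omega

end PackingBound

section Chernoff
open ProbabilityTheory

/-- A Chernoff bound for sums of maxima of finite families of sub-Gaussian variables; the weights
`p` distribute the exponential moment between the families. -/
theorem measure_exists_sum_ge_le {Ω' α : Type*} [MeasurableSpace Ω'] {μ : Measure Ω'}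
    [IsProbabilityMeasure μ] (J : ℕ) (M : ℕ → Finset α) (X : ℕ → α → Ω' → ℝ) (σ : ℕ → ℝ≥0)
    (p : ℕ → ℝ) (hM : ∀ j < J, (M j).Nonempty)
    (hX : ∀ j < J, ∀ u ∈ M j, HasSubgaussianMGF (X j u) (σ j) μ)
    (hp : ∀ j < J, 0 < p j) (hsum : ∑ j ∈ Finset.range J, p j = 1) (ε : ℝ) {r : ℝ} (hr : 0 ≤ r) :
    μ {ω | ∃ u : ℕ → α, (∀ j < J, u j ∈ M j) ∧ ε ≤ ∑ j ∈ Finset.range J, X j (u j) ω} ≤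
      ENNReal.ofReal (exp (-(r * ε) +
        ∑ j ∈ Finset.range J, (p j * log (M j).card + σ j * r ^ 2 / (2 * p j)))) := by
  let b : ℕ → ℝ := fun j => log (M j).card + σ j * (r / p j) ^ 2 / 2
  let W : Ω' → ℝ := fun ω =>
    ∑ j ∈ Finset.range J, p j * ∑ u ∈ M j, exp (r / p j * X j u ω) * exp (-b j)
  have hint (j) (hj : j ∈ Finset.range J) :
      Integrable (fun ω => p j * ∑ u ∈ M j, exp (r / p j * X j u ω) * exp (-b j)) μ :=
    (integrable_finsetSum _ fun u hu =>
      ((hX j (Finset.mem_range.1 hj) u hu).integrable_exp_mul _).mul_const _).const_mul _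
  have hW : Integrable W μ := integrable_finsetSum _ hint
  have hW0 : 0 ≤ W := fun ω => Finset.sum_nonneg fun j hj =>
    mul_nonneg (hp j (Finset.mem_range.1 hj)).le (Finset.sum_nonneg fun u _ => by positivity)
  have hWint : ∫ ω, W ω ∂μ ≤ 1 := by
    rw [integral_finsetSum _ hint, ← hsum]
    refine Finset.sum_le_sum fun j hj => ?_
    have hj' := Finset.mem_range.1 hj
    rw [integral_const_mul]
    refine mul_le_of_le_one_right (hp j hj').le ?_
    rw [integral_finsetSum _ fun u hu =>
      ((hX j hj' u hu).integrable_exp_mul _).mul_const _]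
    have hN : (0 : ℝ) < (M j).card := by exact_mod_cast (hM j hj').card_pos
    calc ∑ u ∈ M j, ∫ ω, exp (r / p j * X j u ω) * exp (-b j) ∂μ
        ≤ ∑ u ∈ M j, exp (σ j * (r / p j) ^ 2 / 2) * exp (-b j) := by
          refine Finset.sum_le_sum fun u hu => ?_
          rw [integral_mul_const]
          exact mul_le_mul_of_nonneg_right ((hX j hj' u hu).mgf_le _) (exp_pos _).le
      _ = 1 := by
          rw [Finset.sum_const, nsmul_eq_mul, ← exp_add]
          have : σ j * (r / p j) ^ 2 / 2 + -b j = -log (M j).card := by simp only [b]; ring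
          rw [this, exp_neg, exp_log hN, mul_inv_cancel₀ hN.ne']
  have hexp : ∑ j ∈ Finset.range J, p j * b j =
      ∑ j ∈ Finset.range J, (p j * log (M j).card + σ j * r ^ 2 / (2 * p j)) := by
    refine Finset.sum_congr rfl fun j hj => ?_
    have := hp j (Finset.mem_range.1 hj)
    simp only [b]
    field_simp
  rw [← hexp]
  set T := ∑ j ∈ Finset.range J, p j * b j with hT
  have hsub : {ω | ∃ u : ℕ → α, (∀ j < J, u j ∈ M j) ∧ ε ≤ ∑ j ∈ Finset.range J, X j (u j) ω} ⊆
      {ω | exp (r * ε - T) ≤ W ω} := by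
    rintro ω ⟨u, hu, hε⟩
    calc exp (r * ε - T) ≤ exp (∑ j ∈ Finset.range J, p j • (r / p j * X j (u j) ω + -b j)) := by
          rw [exp_le_exp]
          have : ∑ j ∈ Finset.range J, p j • (r / p j * X j (u j) ω + -b j) =
              r * ∑ j ∈ Finset.range J, X j (u j) ω - T := by
            rw [hT, Finset.mul_sum, ← Finset.sum_sub_distrib]
            refine Finset.sum_congr rfl fun j hj => ?_
            have := hp j (Finset.mem_range.1 hj)
            rw [smul_eq_mul]
            field_simp
            ring
          rw [this]
          gcongr
      _ ≤ ∑ j ∈ Finset.range J, p j • exp (r / p j * X j (u j) ω + -b j) :=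
          convexOn_exp.map_sum_le (fun j hj => (hp j (Finset.mem_range.1 hj)).le) hsum
            fun _ _ => Set.mem_univ _
      _ ≤ W ω := by
          refine Finset.sum_le_sum fun j hj => ?_
          have hj' := Finset.mem_range.1 hj
          rw [smul_eq_mul]
          refine mul_le_mul_of_nonneg_left ?_ (hp j hj').le
          rw [exp_add]
          exact Finset.single_le_sum (f := fun v => exp (r / p j * X j v ω) * exp (-b j))
            (fun v _ => by positivity) (hu j hj')
  have hmarkov := (mul_meas_ge_le_integral_of_nonneg (.of_forall hW0) hW (exp (r * ε - T))).trans
    hWint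
  have hfin : μ.real {ω | exp (r * ε - T) ≤ W ω} ≤ exp (-(r * ε) + T) := by
    rw [show -(r * ε) + T = -(r * ε - T) by ring, exp_neg, ← one_div,
      le_div_iff₀' (exp_pos _)]
    exact hmarkov
  calc _ ≤ μ {ω | exp (r * ε - T) ≤ W ω} := measure_mono hsub
    _ = ENNReal.ofReal (μ.real {ω | exp (r * ε - T) ≤ W ω}) := by simp
    _ ≤ _ := ENNReal.ofReal_le_ofReal hfin

/-- The gap between the mean of `h` and its empirical mean over the sample `S`. -/
noncomputable def meanGap {Z : Type*} [MeasurableSpace Z] (P : Measure Z) {m : ℕ} (h : Z → ℝ)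
    (S : Fin m → Z) : ℝ :=
  ∫ z, h z ∂P - (1 / (m : ℝ)) * ∑ i, h (S i)

theorem hasSubgaussianMGF_meanGap {Z : Type*} [MeasurableSpace Z] {P : Measure Z}
    [IsProbabilityMeasure P] {m : ℕ} (hm : 0 < m) {h : Z → ℝ} (hh : AEMeasurable h P) {a b : ℝ}
    (hab : ∀ z, h z ∈ Set.Icc a b) :
    HasSubgaussianMGF (meanGap P h) (Real.toNNReal ((b - a) ^ 2 / (4 * m)))
      (Measure.pi fun _ : Fin m => P) := by
  have hm' : (0 : ℝ) < m := by exact_mod_cast hm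
  have h1 : HasSubgaussianMGF (fun z => h z - ∫ z, h z ∂P) ((‖b - a‖₊ / 2) ^ 2) P :=
    hasSubgaussianMGF_of_mem_Icc hh (.of_forall hab)
  have hind : iIndepFun (fun (i : Fin m) (S : Fin m → Z) => h (S i) - ∫ z, h z ∂P)
      (Measure.pi fun _ : Fin m => P) :=
    iIndepFun_pi (X := fun _ z => h z - ∫ z, h z ∂P) fun i => hh.sub_const _
  have h2 := HasSubgaussianMGF.sum_of_iIndepFun hind (s := Finset.univ)
    (c := fun _ => (‖b - a‖₊ / 2) ^ 2) fun i _ => by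
      refine HasSubgaussianMGF.of_map (Y := fun S : Fin m → Z => S i)
        (X := fun z => h z - ∫ z, h z ∂P) (measurable_pi_apply i).aemeasurable ?_
      rwa [(measurePreserving_eval (fun _ : Fin m => P) i).map_eq]
  have h3 := h2.const_mul (-(1 / (m : ℝ)))
  convert h3 using 1
  · funext S
    simp only [meanGap, Finset.sum_sub_distrib, Finset.sum_const, Finset.card_univ,
      Fintype.card_fin, nsmul_eq_mul]
    field_simp
    ring
  · ext
    rw [Real.coe_toNNReal _ (by positivity)]
    change _ = (-(1 / (m : ℝ))) ^ 2 * ((∑ _i : Fin m, (‖b - a‖₊ / 2) ^ 2 : ℝ≥0) : ℝ)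
    simp
    field_simp
    rw [sq_abs]
    ring

end Chernoff

section Chaining
open Module ProbabilityTheory

theorem sum_half_pow_mul_add_le {A G : ℝ} (hA : 0 ≤ A) (hG : 0 ≤ G) (n : ℕ) :
    ∑ k ∈ Finset.range n, (1 / 2 : ℝ) ^ k * (A + k * G) ≤ 2 * A + 2 * G := by
  have h : ∑ k ∈ Finset.range n, (1 / 2 : ℝ) ^ k * (A + k * G) =
      2 * A + 2 * G - (1 / 2 : ℝ) ^ n * (2 * A + 2 * (n + 1) * G) := by
    induction n with
    | zero => simp
    | succ n ih => rw [Finset.sum_range_succ, ih]; push_cast; ring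
  rw [h]
  have : 0 ≤ (1 / 2 : ℝ) ^ n * (2 * A + 2 * (n + 1) * G) := by positivity
  linarith

/-- Points of `M n` are endpoints of chains descending through the parent maps to `M 0`. -/
theorem exists_chain {α : Type*} (M : ℕ → Finset α) (par : ℕ → α → α)
    (hpar : ∀ k, ∀ u ∈ M (k + 1), par k u ∈ M k) (X : ℕ → α → ℝ) (Φ : α → ℝ)
    (hX0 : ∀ u, X 0 u = Φ u) (hX : ∀ k u, X (k + 1) u = Φ u - Φ (par k u)) (n : ℕ) :
    ∀ u ∈ M n, ∃ s : ℕ → α, (∀ j < n + 1, s j ∈ M j) ∧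
      Φ u = ∑ j ∈ Finset.range (n + 1), X j (s j) := by
  classical
  induction n with
  | zero => exact fun u hu => ⟨fun _ => u, by simpa using hu, by simp [hX0]⟩
  | succ n ih =>
    intro u hu
    obtain ⟨s, hs, hsum⟩ := ih _ (hpar n u hu)
    refine ⟨Function.update s (n + 1) u, fun j hj => ?_, ?_⟩
    · rcases eq_or_ne j (n + 1) with rfl | hne
      · simpa using hu
      · rw [Function.update_of_ne hne]
        exact hs j (by omega)
    · rw [Finset.sum_range_succ, Function.update_self, hX, Finset.sum_congr rfl
        (g := fun j => X j (s j)) fun j hj => by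
          rw [Function.update_of_ne (Finset.mem_range.1 hj).ne], ← hsum]
      ring

theorem meanGap_sub {Z : Type*} [MeasurableSpace Z] {P : Measure Z} {m : ℕ} {g h : Z → ℝ}
    (hg : Integrable g P) (hh : Integrable h P) (S : Fin m → Z) :
    meanGap P (fun z => g z - h z) S = meanGap P g S - meanGap P h S := by
  simp only [meanGap, integral_sub hg hh, Finset.sum_sub_distrib]
  ring

theorem meanGap_le {Z : Type*} [MeasurableSpace Z] {P : Measure Z} [IsProbabilityMeasure P]
    {m : ℕ} (hm : 0 < m) {h : Z → ℝ} {w : ℝ} (hw : ∀ z, |h z| ≤ w) (S : Fin m → Z) :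
    meanGap P h S ≤ 2 * w := by
  have hm' : (0 : ℝ) < m := by exact_mod_cast hm
  have h1 : ∫ z, h z ∂P ≤ w := by
    have := norm_integral_le_of_norm_le_const (μ := P) (f := h) (C := w) (.of_forall hw)
    simp only [probReal_univ, mul_one] at this
    exact (le_abs_self _).trans this
  have h2 : -w ≤ (1 / (m : ℝ)) * ∑ i, h (S i) := by
    have : ∑ _i : Fin m, -w ≤ ∑ i, h (S i) :=
      Finset.sum_le_sum fun i _ => (abs_le.1 (hw (S i))).1
    rw [Finset.sum_const, Finset.card_univ, Fintype.card_fin, nsmul_eq_mul] at this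
    calc -w = (1 / (m : ℝ)) * (m * -w) := by field_simp
      _ ≤ _ := by gcongr
  simp only [meanGap]
  linarith

/-- The exponent appearing in the chaining bound is at most `-T` for large samples. -/
theorem chaining_exponent_le {B' L c D ε T x m : ℝ} (hB' : 0 < B') (hL : 0 < L)
    (hB'c : L * B' ≤ c) (hD : 0 < D) (hε : 0 < ε) (hT : 0 < T) (hx : 1 ≤ x) (hm : 0 < m)
    (hbound : 1024 * ((x * B') ^ 2 * L ^ 2 * D + c ^ 2 * T) ≤ ε ^ 2 * m) {Λ θ q : ℝ}
    (hΛ : Λ = D * log (6 * x)) (hθ : θ = T / (2 * T + Λ)) (hq : 1 / 2 ≤ q) :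
    -(8 * T / ε * (ε / 2)) + c ^ 2 / (4 * m) * (8 * T / ε) ^ 2 / (2 * q) +
      (θ * Λ + 8 * L ^ 2 * B' ^ 2 * (8 * T / ε) ^ 2 / (m * θ)) ≤ -T := by
  have hlog : 0 ≤ log (6 * x) := log_nonneg (by linarith)
  have hΛ0 : 0 ≤ Λ := hΛ ▸ mul_nonneg hD.le hlog
  have hlogle : log (6 * x) ≤ 2 * x ^ 2 := by
    rw [log_mul (by norm_num) (by linarith)]
    have h6 : log 6 ≤ 2 := by
      rw [log_le_iff_le_exp (by norm_num)]
      have h1 := exp_one_gt_d9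
      have h2 : exp 2 = exp 1 * exp 1 := by rw [← exp_add]; norm_num
      rw [h2]
      nlinarith
    have := log_le_sub_one_of_pos (show 0 < x by linarith)
    nlinarith
  have h0 : 8 * T / ε * (ε / 2) = 4 * T := by field_simp; ring
  have hc2 : 0 ≤ c ^ 2 := sq_nonneg c
  have hB2 : 0 ≤ (x * B') ^ 2 * L ^ 2 * D := by positivity
  have h1 : c ^ 2 / (4 * m) * (8 * T / ε) ^ 2 / (2 * q) ≤ T := by
    have hq0 : 0 < q := by linarith
    rw [show c ^ 2 / (4 * m) * (8 * T / ε) ^ 2 / (2 * q) = 8 * T * (c ^ 2 * T) / (ε ^ 2 * m * q) by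
      field_simp; ring, div_le_iff₀ (by positivity)]
    have : 8 * (c ^ 2 * T) ≤ ε ^ 2 * m * q := by
      have : 0 ≤ c ^ 2 * T := by positivity
      have : 0 ≤ ε ^ 2 * m := by positivity
      nlinarith
    nlinarith
  have h2 : θ * Λ ≤ T := by
    rw [hθ, div_mul_eq_mul_div, div_le_iff₀ (by positivity)]
    nlinarith
  have h3 : 8 * L ^ 2 * B' ^ 2 * (8 * T / ε) ^ 2 / (m * θ) ≤ T := by
    rw [hθ, show 8 * L ^ 2 * B' ^ 2 * (8 * T / ε) ^ 2 / (m * (T / (2 * T + Λ))) =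
      T * (512 * (L * B') ^ 2 * (2 * T + Λ)) / (ε ^ 2 * m) by field_simp; ring,
      div_le_iff₀ (by positivity)]
    refine mul_le_mul_of_nonneg_left (le_trans ?_ hbound) hT.le
    have e1 : (L * B') ^ 2 * T ≤ c ^ 2 * T := by gcongr
    have e2 : (L * B') ^ 2 * Λ ≤ (L * B') ^ 2 * (D * (2 * x ^ 2)) := by
      rw [hΛ]; gcongr
    nlinarith
  rw [h0]
  linarith

/-- Uniform deviation inequality, by chaining, for a Lipschitz family of bounded functions indexed
by a subset of a ball of a finite-dimensional normed space. -/
theorem measure_exists_lt_meanGap_le {E Z : Type*} [NormedAddCommGroup E] [NormedSpace ℝ E]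
    [FiniteDimensional ℝ E] [MeasurableSpace Z] (P : Measure Z) [IsProbabilityMeasure P]
    (h : E → Z → ℝ) (K : Set E) {B c L D ε δ : ℝ} {m : ℕ} (hB : 0 < B) (hc : 0 < c) (hL : 0 < L)
    (hD : 0 < D) (hdim : (finrank ℝ E : ℝ) ≤ D) (hK : ∀ v ∈ K, ‖v‖ ≤ B)
    (hmeas : ∀ v ∈ K, AEMeasurable (h v) P) (hrange : ∀ v z, h v z ∈ Set.Icc 0 c)
    (hlip : ∀ u v z, |h u z - h v z| ≤ L * ‖u - v‖) (hε : 0 < ε) (hδ : δ ∈ Set.Ioo (0 : ℝ) 1)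
    (hm : 0 < m)
    (hbound : 1024 * (B ^ 2 * L ^ 2 * D + c ^ 2 * log (1 / δ)) ≤ ε ^ 2 * m) :
    (Measure.pi fun _ : Fin m => P) {S | ∃ v ∈ K, ε < meanGap P (h v) S} ≤ ENNReal.ofReal δ := by
  rcases K.eq_empty_or_nonempty with rfl | ⟨v₀, hv₀⟩
  · simp
  have hm' : (0 : ℝ) < m := by exact_mod_cast hm
  set T := log (1 / δ) with hTdef
  have hT : 0 < T := log_pos (by rw [lt_div_iff₀ hδ.1]; linarith [hδ.2])
  -- Scales below `c / L` suffice, since increments are also bounded by `c`.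
  set B' := min B (c / L) with hB'def
  have hB' : 0 < B' := lt_min hB (by positivity)
  have hB'B : B' ≤ B := min_le_left _ _
  have hB'c : L * B' ≤ c := by
    rw [← le_div_iff₀' hL]; exact min_le_right _ _
  set x := B / B' with hxdef
  have hx : 1 ≤ x := (one_le_div hB').2 hB'B
  have hxB : x * B' = B := by rw [hxdef]; field_simp
  choose N hNK hNnet hNcard using fun k : ℕ =>
    exists_finset_net hB.le (show 0 < B' * (1 / 2 : ℝ) ^ k by positivity) hK
  let M : ℕ → Finset E := fun j => Nat.casesOn j {v₀} N
  have hMK : ∀ j, ∀ u ∈ M j, u ∈ K := by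
    rintro (_ | j) u hu
    · rwa [Finset.mem_singleton.1 hu]
    · exact hNK j u hu
  let w : ℕ → ℝ := fun k => 2 * (L * B') * (1 / 2 : ℝ) ^ k
  have hw : ∀ k, ∀ v ∈ K, ∃ u ∈ M k, ∀ z, |h v z - h u z| ≤ w k := by
    rintro (_ | k) v hv
    · refine ⟨v₀, Finset.mem_singleton_self _, fun z => ?_⟩
      simp only [w, pow_zero, mul_one]
      rcases le_total B (c / L) with hle | hle
      · rw [hB'def, min_eq_left hle]
        refine (hlip _ _ z).trans ?_
        have := norm_sub_le v v₀
        nlinarith [hK v hv, hK v₀ hv₀]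
      · rw [hB'def, min_eq_right hle, mul_div_cancel₀ _ hL.ne']
        have h1 := hrange v z
        have h2 := hrange v₀ z
        rw [abs_le]
        constructor <;> linarith [h1.1, h1.2, h2.1, h2.2]
    · obtain ⟨u, hu, hvu⟩ := hNnet k v hv
      refine ⟨u, hu, fun z => (hlip _ _ z).trans ?_⟩
      calc L * ‖v - u‖ ≤ L * (B' * (1 / 2 : ℝ) ^ k) := by gcongr
        _ = w (k + 1) := by simp only [w]; ring
  have hw' : ∀ k v, ∃ u, v ∈ K → u ∈ M k ∧ ∀ z, |h v z - h u z| ≤ w k := fun k v => by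
    by_cases hv : v ∈ K
    · obtain ⟨u, hu, hvu⟩ := hw k v hv
      exact ⟨u, fun _ => ⟨hu, hvu⟩⟩
    · exact ⟨v, fun hv' => absurd hv' hv⟩
  choose par hpar using hw'
  obtain ⟨n, hn⟩ : ∃ n : ℕ, 2 * w n ≤ ε / 2 := by
    obtain ⟨n, hn⟩ := exists_pow_lt_of_lt_one (show 0 < ε / (8 * (L * B')) by positivity)
      (show (1 / 2 : ℝ) < 1 by norm_num)
    refine ⟨n, ?_⟩
    rw [lt_div_iff₀ (by positivity)] at hn
    simp only [w]
    linarith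
  have hint : ∀ v ∈ K, Integrable (h v) P := fun v hv =>
    Integrable.of_mem_Icc 0 c (hmeas v hv) (.of_forall (hrange v))
  let X : ℕ → E → (Fin m → Z) → ℝ := fun j u S =>
    Nat.casesOn j (meanGap P (h u) S) fun k => meanGap P (h u) S - meanGap P (h (par k u)) S
  let σ : ℕ → ℝ≥0 := fun j => Nat.casesOn j (Real.toNNReal (c ^ 2 / (4 * m)))
    fun k => Real.toNNReal (w k ^ 2 / m)
  have hXsub : ∀ j < n + 1, ∀ u ∈ M j,
      HasSubgaussianMGF (X j u) (σ j) (Measure.pi fun _ : Fin m => P) := by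
    rintro (_ | k) - u hu
    · have := hasSubgaussianMGF_meanGap hm (hmeas u (hMK 0 u hu)) (hrange u)
      rwa [sub_zero] at this
    · have huK := hMK (k + 1) u hu
      have hpK := hMK k _ (hpar k u huK).1
      have := hasSubgaussianMGF_meanGap (P := P) hm
        ((hmeas u huK).sub (hmeas _ hpK)) (fun z => abs_le.1 ((hpar k u huK).2 z))
      rw [show (w k - -w k) ^ 2 / (4 * (m : ℝ)) = w k ^ 2 / m by field_simp; ring] at this
      convert this using 1
      funext S
      exact (meanGap_sub (hint u huK) (hint _ hpK) S).symm
  set Λ := D * log (6 * x) with hΛ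
  have hΛ0 : 0 ≤ Λ := mul_nonneg hD.le (log_nonneg (by linarith))
  set θ := T / (2 * T + Λ) with hθ
  have hθ0 : 0 < θ := by positivity
  have hθ2 : θ ≤ 1 / 2 := by
    rw [hθ, div_le_iff₀ (by positivity)]; linarith
  let r : ℕ → ℝ := fun k => θ / 2 * (1 / 2 : ℝ) ^ k
  have hrpos : ∀ k, 0 < r k := fun k => by positivity
  have hrsum : ∑ k ∈ Finset.range n, r k ≤ 1 / 2 := by
    have := sum_half_pow_mul_add_le (A := θ / 2) (G := 0) (by positivity) le_rfl n
    simp only [mul_zero, add_zero] at this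
    calc ∑ k ∈ Finset.range n, r k = ∑ k ∈ Finset.range n, (1 / 2 : ℝ) ^ k * (θ / 2) :=
          Finset.sum_congr rfl fun k _ => mul_comm _ _
      _ ≤ 1 / 2 := by linarith
  set q := 1 - ∑ k ∈ Finset.range n, r k with hq
  let p : ℕ → ℝ := fun j => Nat.casesOn j q r
  have htail := measure_exists_sum_ge_le (μ := Measure.pi fun _ : Fin m => P) (n + 1) M X σ p
    (by
      rintro (_ | k) -
      · exact Finset.singleton_nonempty _
      · obtain ⟨u, hu, -⟩ := hw (k + 1) v₀ hv₀
        exact ⟨u, hu⟩)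
    hXsub
    (by
      rintro (_ | k) -
      · show 0 < q
        linarith
      · exact hrpos k)
    (by
      rw [Finset.sum_range_succ']
      show ∑ k ∈ Finset.range n, r k + q = 1
      rw [hq]; ring)
    (ε / 2) (r := 8 * T / ε) (by positivity)
  have hlevel : ∑ k ∈ Finset.range n,
      (r k * log (N k).card + w k ^ 2 / m * (8 * T / ε) ^ 2 / (2 * r k)) ≤
      θ * Λ + 8 * L ^ 2 * B' ^ 2 * (8 * T / ε) ^ 2 / (m * θ) := by
    have hlog3 : 0 ≤ log (3 * x) := log_nonneg (by linarith)
    have hlog2 : 0 ≤ log 2 := log_nonneg (by norm_num)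
    calc _ ≤ ∑ k ∈ Finset.range n, (1 / 2 : ℝ) ^ k * ((θ / 2 * (D * log (3 * x)) +
            4 * L ^ 2 * B' ^ 2 * (8 * T / ε) ^ 2 / (m * θ)) + k * (θ / 2 * (D * log 2))) := by
          refine Finset.sum_le_sum fun k _ => ?_
          have hcard : log (N k).card ≤ D * (log (3 * x) + k * log 2) := by
            have hNpos : (0 : ℝ) < (N k).card := by
              obtain ⟨u, hu, -⟩ := hNnet k v₀ hv₀
              exact_mod_cast Finset.card_pos.2 ⟨u, hu⟩
            have h2k : (1 : ℝ) ≤ 2 ^ k := one_le_pow₀ (by norm_num)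
            have hbase : 1 + 2 * B / (B' * (1 / 2 : ℝ) ^ k) ≤ 3 * x * 2 ^ k := by
              have : 2 * B / (B' * (1 / 2 : ℝ) ^ k) = 2 * x * 2 ^ k := by
                rw [hxdef, one_div, inv_pow]; field_simp
              rw [this]
              nlinarith
            have hbase0 : 0 < 1 + 2 * B / (B' * (1 / 2 : ℝ) ^ k) := by positivity
            calc log (N k).card
                ≤ finrank ℝ E * log (1 + 2 * B / (B' * (1 / 2 : ℝ) ^ k)) := by
                  rw [← log_pow]; exact log_le_log hNpos (hNcard k)
              _ ≤ finrank ℝ E * log (3 * x * 2 ^ k) := by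
                  gcongr
              _ = finrank ℝ E * (log (3 * x) + k * log 2) := by
                  rw [log_mul (by positivity) (by positivity), log_pow]
              _ ≤ _ := by gcongr
          have hvar : w k ^ 2 / m * (8 * T / ε) ^ 2 / (2 * r k) =
              (1 / 2 : ℝ) ^ k * (4 * L ^ 2 * B' ^ 2 * (8 * T / ε) ^ 2 / (m * θ)) := by
            simp only [w, r]
            have : (1 / 2 : ℝ) ^ k ≠ 0 := by positivity
            generalize (1 / 2 : ℝ) ^ k = y at *
            field_simp
            ring
          rw [hvar]
          have := mul_le_mul_of_nonneg_left hcard (hrpos k).le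
          simp only [r] at this ⊢
          linarith
      _ ≤ 2 * (θ / 2 * (D * log (3 * x)) + 4 * L ^ 2 * B' ^ 2 * (8 * T / ε) ^ 2 / (m * θ)) +
            2 * (θ / 2 * (D * log 2)) :=
          sum_half_pow_mul_add_le (by positivity) (by positivity) n
      _ = _ := by
          have hlog6 : log (6 * x) = log (3 * x) + log 2 := by
            rw [← log_mul (by linarith) (by norm_num)]; ring_nf
          rw [hΛ, hlog6]
          ring
  have hexponent := chaining_exponent_le hB' hL hB'c hD hε hT hx hm' (by rwa [hxB]) hΛ hθ
    (show 1 / 2 ≤ q by linarith)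
  have hfinal : -(8 * T / ε * (ε / 2)) + ∑ j ∈ Finset.range (n + 1),
      (p j * log (M j).card + NNReal.toReal (σ j) * (8 * T / ε) ^ 2 / (2 * p j)) ≤ -T := by
    rw [Finset.sum_range_succ']
    have e0 : p 0 * log (M 0).card + NNReal.toReal (σ 0) * (8 * T / ε) ^ 2 / (2 * p 0) =
        c ^ 2 / (4 * m) * (8 * T / ε) ^ 2 / (2 * q) := by
      change q * log (({v₀} : Finset E).card : ℝ) +
        NNReal.toReal (Real.toNNReal (c ^ 2 / (4 * m))) * (8 * T / ε) ^ 2 / (2 * q) = _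
      rw [Finset.card_singleton, Nat.cast_one, log_one, mul_zero, zero_add,
        Real.coe_toNNReal _ (by positivity)]
    have e1 : ∀ k, p (k + 1) * log (M (k + 1)).card + NNReal.toReal (σ (k + 1)) * (8 * T / ε) ^ 2 /
        (2 * p (k + 1)) = r k * log (N k).card + w k ^ 2 / m * (8 * T / ε) ^ 2 / (2 * r k) := by
      intro k
      change r k * log ((N k).card : ℝ) +
        NNReal.toReal (Real.toNNReal (w k ^ 2 / m)) * (8 * T / ε) ^ 2 / (2 * r k) = _
      rw [Real.coe_toNNReal _ (by positivity)]
    rw [e0, Finset.sum_congr rfl fun k _ => e1 k]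
    linarith
  refine (measure_mono ?_).trans (htail.trans (ENNReal.ofReal_le_ofReal ?_))
  · rintro S ⟨v, hv, hgap⟩
    obtain ⟨hu, hvu⟩ := hpar n v hv
    obtain ⟨s, hs, hsum⟩ := exists_chain M par (fun k u hu => (hpar k u (hMK (k + 1) u hu)).1)
      (fun j u => X j u S) (fun u => meanGap P (h u) S) (fun _ => rfl) (fun _ _ => rfl) n _ hu
    refine ⟨s, hs, ?_⟩
    rw [← hsum]
    have := meanGap_le (P := P) hm hvu S
    rw [meanGap_sub (hint v hv) (hint _ (hMK n _ hu))] at this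
    linarith
  · refine (exp_le_exp.2 hfinal).trans ?_
    rw [hTdef, one_div, log_inv, neg_neg, exp_log hδ.1]

end Chaining

section TrigonometricSpace
open Module BoundedContinuousFunction

theorem continuous_dot {d : ℕ} (ω : Fin d → ℝ) : Continuous (dot ω) :=
  continuous_finsetSum _ fun j _ => continuous_const.mul (continuous_apply j)

/-- The functions `1`, `cos (ω · x)` and `sin (ω · x)`, `ω ∈ Ω₊`, restricted to the box. -/
noncomputable def trigFun {d : ℕ} (Ωp : Finset (Fin d → ℝ)) :
    Unit ⊕ (Ωp ⊕ Ωp) → BoundedContinuousFunction (box d) ℝ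
  | .inl _ => .const _ 1
  | .inr (.inl ω) => .ofNormedAddCommGroup (fun x => cos (dot ω.1 x.1))
      (continuous_cos.comp ((continuous_dot ω.1).comp continuous_subtype_val)) 1
      fun _ => abs_cos_le_one _
  | .inr (.inr ω) => .ofNormedAddCommGroup (fun x => sin (dot ω.1 x.1))
      (continuous_sin.comp ((continuous_dot ω.1).comp continuous_subtype_val)) 1
      fun _ => abs_sin_le_one _

theorem exists_mem_span_trigFun {d : ℕ} (Ωp : Finset (Fin d → ℝ)) (a0 : ℝ)
    (a b : (Fin d → ℝ) → ℝ) :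
    ∃ v : Submodule.span ℝ (Set.range (trigFun Ωp)), ∀ x : box d, v.1 x = gtp Ωp a0 a b x := by
  let coef : Unit ⊕ (Ωp ⊕ Ωp) → ℝ :=
    Sum.elim (fun _ => a0 / 2) (Sum.elim (fun ω => a ω) fun ω => b ω)
  refine ⟨⟨∑ i, coef i • trigFun Ωp i, Submodule.sum_mem _ fun i _ =>
    Submodule.smul_mem _ _ (Submodule.subset_span ⟨i, rfl⟩)⟩, fun x => ?_⟩
  simp only [Fintype.sum_sum_type, BoundedContinuousFunction.coe_add,
    BoundedContinuousFunction.coe_sum, Pi.add_apply, Finset.sum_apply,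
    BoundedContinuousFunction.coe_smul, smul_eq_mul]
  simp only [coef, trigFun, gtp, Sum.elim_inl, Sum.elim_inr, Finset.univ_unique,
    Finset.sum_singleton, BoundedContinuousFunction.const_apply,
    BoundedContinuousFunction.coe_ofNormedAddCommGroup, mul_one, Finset.sum_add_distrib]
  rw [Finset.sum_coe_sort Ωp fun ω => a ω * cos (dot ω x.1),
    Finset.sum_coe_sort Ωp fun ω => b ω * sin (dot ω x.1)]

theorem finrank_span_trigFun_le {d : ℕ} (Ωp : Finset (Fin d → ℝ)) :
    (finrank ℝ (Submodule.span ℝ (Set.range (trigFun Ωp))) : ℝ) ≤ 2 * Ωp.card + 1 := by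
  have := finrank_range_le_card (R := ℝ) (trigFun Ωp)
  simp only [Set.finrank, Fintype.card_sum, Fintype.card_unit, Fintype.card_coe] at this
  exact_mod_cast (show finrank ℝ (Submodule.span ℝ (Set.range (trigFun Ωp))) ≤
    2 * Ωp.card + 1 by omega)

end TrigonometricSpace

theorem measurableSet_box (d : ℕ) : MeasurableSet (box d) :=
  MeasurableSet.univ_pi fun _ => measurableSet_Ico

/-- Loss of a bounded continuous function on the box, extended by zero off the box. -/
noncomputable def boxLoss {d : ℕ} (ℓ : ℝ → ℝ → ℝ) (v : BoundedContinuousFunction (box d) ℝ)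
    (p : (Fin d → ℝ) × ℝ) : ℝ :=
  open Classical in if hp : p.1 ∈ box d then ℓ p.2 (v ⟨p.1, hp⟩) else 0

theorem boxLoss_mem_Icc {d : ℕ} {ℓ : ℝ → ℝ → ℝ} {c : ℝ} (hc : 0 ≤ c)
    (hℓ : ∀ y z, ℓ y z ∈ Set.Icc 0 c) (v : BoundedContinuousFunction (box d) ℝ)
    (p : (Fin d → ℝ) × ℝ) : boxLoss ℓ v p ∈ Set.Icc 0 c := by
  unfold boxLoss
  split_ifs
  exacts [hℓ _ _, ⟨le_rfl, hc⟩]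

theorem abs_boxLoss_sub_le {d : ℕ} {ℓ : ℝ → ℝ → ℝ} {L : ℝ} (hL : 0 ≤ L)
    (hℓ : ∀ y : ℝ, LipschitzWith (Real.toNNReal L) fun z => ℓ y z)
    (u v : BoundedContinuousFunction (box d) ℝ) (p : (Fin d → ℝ) × ℝ) :
    |boxLoss ℓ u p - boxLoss ℓ v p| ≤ L * ‖u - v‖ := by
  unfold boxLoss
  split_ifs with hp
  · have h1 := (hℓ p.2).dist_le_mul (u ⟨p.1, hp⟩) (v ⟨p.1, hp⟩)
    rw [Real.coe_toNNReal _ hL, Real.dist_eq] at h1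
    refine h1.trans (mul_le_mul_of_nonneg_left ?_ hL)
    rw [← dist_eq_norm]
    exact BoundedContinuousFunction.dist_coe_le_dist _
  · simpa using mul_nonneg hL (norm_nonneg _)

/-- The uniform deviation event for trigonometric polynomials, up to samples leaving the box. -/
theorem exists_lt_meanGap_boxLoss {d m : ℕ} {Ωp : Finset (Fin d → ℝ)} {B ε : ℝ} (hB : 0 ≤ B)
    (hε : 0 ≤ ε) {ℓ : ℝ → ℝ → ℝ} (hℓ : ∀ y z, 0 ≤ ℓ y z) {P : Measure ((Fin d → ℝ) × ℝ)}
    (hP : ∀ᵐ p ∂P, p.1 ∈ box d) {S : Fin m → (Fin d → ℝ) × ℝ} (hS : ∀ i, (S i).1 ∈ box d)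
    {f : (Fin d → ℝ) → ℝ} (hf : f ∈ FclassSup Ωp B) (hgap : ε < risk P ℓ f - empRisk ℓ S f) :
    ∃ v : Submodule.span ℝ (Set.range (trigFun Ωp)),
      (‖v‖ ≤ B ∧ AEMeasurable (boxLoss ℓ v.1) P) ∧ ε < meanGap P (boxLoss ℓ v.1) S := by
  obtain ⟨⟨a0, a, b, rfl⟩, hfB⟩ := hf
  obtain ⟨v, hv⟩ := exists_mem_span_trigFun Ωp a0 a b
  have hloss : ∀ p : (Fin d → ℝ) × ℝ, p.1 ∈ box d →
      ℓ p.2 (gtp Ωp a0 a b p.1) = boxLoss ℓ v.1 p := fun p hp => by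
    rw [boxLoss, dif_pos hp, hv ⟨p.1, hp⟩]
  have hae : (fun p : (Fin d → ℝ) × ℝ => ℓ p.2 (gtp Ωp a0 a b p.1)) =ᵐ[P] boxLoss ℓ v.1 := by
    filter_upwards [hP] with p hp using hloss p hp
  refine ⟨v, ⟨?_, ?_⟩, ?_⟩
  · refine (BoundedContinuousFunction.norm_le hB).2 fun x => ?_
    change |v.1 x| ≤ B
    rw [hv x]
    exact hfB x.1 x.2
  -- A loss that is not measurable has risk `0` by convention, hence no positive gap.
  · by_contra hmeas
    have hrisk : risk P ℓ (gtp Ωp a0 a b) = 0 :=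
      integral_non_aestronglyMeasurable fun h => hmeas (h.congr hae).aemeasurable
    have hemp : 0 ≤ empRisk ℓ S (gtp Ωp a0 a b) :=
      mul_nonneg (by positivity) (Finset.sum_nonneg fun i _ => hℓ _ _)
    linarith
  · have hrisk : risk P ℓ (gtp Ωp a0 a b) = ∫ p, boxLoss ℓ v.1 p ∂P := integral_congr_ae hae
    have hemp : empRisk ℓ S (gtp Ωp a0 a b) = (1 / (m : ℝ)) * ∑ i, boxLoss ℓ v.1 (S i) := by
      simp only [empRisk, hloss _ (hS _)]
    rwa [meanGap, ← hrisk, ← hemp]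

/-- Sample complexity bound (Version 2): there is a universal constant
`C > 0` such that a sample of size
`m ≥ C·ε⁻²·(B²·L²·|Ω|·(log|Ω| + log(3B̃)) + c²·log(1/δ))` suffices to guarantee,
with probability at least `1 − δ`, generalization gap at most `ε` uniformly over the
class `F` of `B`-sup-norm-bounded generalized trigonometric polynomials, where
`|Ω| = 2|Ω₊| + 1`. -/
theorem sample_complexity_gtp_covering :
    ∃ C : ℝ, 0 < C ∧
      ∀ (d : ℕ), 1 ≤ d → ∀ (Ωp : Finset (Fin d → ℝ)), Ωp.Nonempty →
        (∀ ω ∈ Ωp, ω ≠ 0) → (∀ ω ∈ Ωp, -ω ∉ Ωp) →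
        ∀ (B : ℝ), 0 < B → ∀ (Bt : ℝ), 1 ≤ Bt →
          FclassSup Ωp B ⊆ Hclass Ωp Bt →
        ∀ (c L : ℝ), 0 < c → 0 < L →
        ∀ (ℓ : ℝ → ℝ → ℝ), (∀ y z, ℓ y z ∈ Set.Icc 0 c) →
          (∀ y : ℝ, LipschitzWith (Real.toNNReal L) fun z => ℓ y z) →
        ∀ (ε δ : ℝ), ε ∈ Set.Ioo (0 : ℝ) 1 → δ ∈ Set.Ioo (0 : ℝ) 1 →
        ∀ (P : Measure ((Fin d → ℝ) × ℝ)), IsProbabilityMeasure P →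
          P {p | p.1 ∈ box d} = 1 →
        ∀ (m : ℕ),
          C * ε⁻¹ ^ 2 *
              (B ^ 2 * L ^ 2 * (2 * Ωp.card + 1) *
                  (Real.log (2 * Ωp.card + 1) + Real.log (3 * Bt)) +
                c ^ 2 * Real.log (1 / δ)) ≤ (m : ℝ) →
          ENNReal.ofReal (1 - δ) ≤
            (Measure.pi fun _ : Fin m => P)
              {S | ∀ f ∈ FclassSup Ωp B, risk P ℓ f - empRisk ℓ S f ≤ ε} := by
  refine ⟨1024, by norm_num, ?_⟩
  intro d _ Ωp hne _ _ B hB Bt hBt _ c L hc hL ℓ hℓ hlip ε δ hε hδ P hPprob hPbox m hm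
  have hcard : (1 : ℝ) ≤ Ωp.card := by exact_mod_cast hne.card_pos
  have hT : 0 < log (1 / δ) := log_pos (by rw [lt_div_iff₀ hδ.1]; linarith [hδ.2])
  have hlog : 1 ≤ log (2 * Ωp.card + 1) + log (3 * Bt) := by
    have h1 : 1 ≤ log (2 * (Ωp.card : ℝ) + 1) := by
      rw [le_log_iff_exp_le (by positivity)]
      linarith [exp_one_lt_d9]
    have h2 : 0 ≤ log (3 * Bt) := log_nonneg (by linarith)
    linarith
  have hbound : 1024 * (B ^ 2 * L ^ 2 * (2 * Ωp.card + 1) + c ^ 2 * log (1 / δ)) ≤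
      ε ^ 2 * m := by
    have hle : B ^ 2 * L ^ 2 * (2 * Ωp.card + 1) ≤ B ^ 2 * L ^ 2 * (2 * Ωp.card + 1) *
        (log (2 * Ωp.card + 1) + log (3 * Bt)) :=
      le_mul_of_one_le_right (by positivity) hlog
    have hε2 : 0 < ε ^ 2 := pow_pos hε.1 2
    have := mul_le_mul_of_nonneg_left hm hε2.le
    rw [inv_pow, mul_comm (1024 : ℝ), mul_assoc, mul_inv_cancel_left₀ hε2.ne'] at this
    linarith
  have hm0 : 0 < m := by
    rcases Nat.eq_zero_or_pos m with rfl | h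
    · have : 0 < B ^ 2 * L ^ 2 * (2 * (Ωp.card : ℝ) + 1) + c ^ 2 * log (1 / δ) := by positivity
      simp only [Nat.cast_zero, mul_zero] at hbound
      linarith
    · exact h
  have hPae : ∀ᵐ p ∂P, p.1 ∈ box d := by
    rw [ae_iff]
    exact (prob_compl_eq_zero_iff (measurable_fst (measurableSet_box d))).2 hPbox
  let K : Set (Submodule.span ℝ (Set.range (trigFun Ωp))) :=
    {v | ‖v‖ ≤ B ∧ AEMeasurable (boxLoss ℓ v.1) P}
  have : FiniteDimensional ℝ (Submodule.span ℝ (Set.range (trigFun Ωp))) :=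
    FiniteDimensional.span_of_finite ℝ (Set.finite_range _)
  have hdev := measure_exists_lt_meanGap_le P
    (fun v : Submodule.span ℝ (Set.range (trigFun Ωp)) => boxLoss ℓ v.1) K hB hc hL
    (by positivity) (finrank_span_trigFun_le Ωp) (fun v hv => hv.1) (fun v hv => hv.2)
    (fun v => boxLoss_mem_Icc hc.le hℓ v.1) (fun u v => abs_boxLoss_sub_le hL.le hlip u.1 v.1)
    hε.1 hδ hm0 hbound
  have hSae : ∀ᵐ S ∂(Measure.pi fun _ : Fin m => P), ∀ i, (S i).1 ∈ box d :=
    ae_all_iff.2 fun i =>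
      (Measure.quasiMeasurePreserving_eval (fun _ : Fin m => P) i).ae hPae
  set G := {S : Fin m → (Fin d → ℝ) × ℝ | ∀ f ∈ FclassSup Ωp B,
    risk P ℓ f - empRisk ℓ S f ≤ ε}
  have hbad : (Measure.pi fun _ : Fin m => P) Gᶜ ≤ ENNReal.ofReal δ := by
    refine (measure_mono_ae ?_).trans hdev
    filter_upwards [hSae] with S hS hSG
    obtain ⟨f, hf, hgap⟩ : ∃ f ∈ FclassSup Ωp B, ε < risk P ℓ f - empRisk ℓ S f := by
      by_contra! hall
      exact hSG hall
    exact exists_lt_meanGap_boxLoss hB.le hε.1.le (fun y z => (hℓ y z).1) hPae hS hf hgap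
  have htotal : 1 ≤ (Measure.pi fun _ : Fin m => P) G + ENNReal.ofReal δ := by
    calc (1 : ℝ≥0∞) = (Measure.pi fun _ : Fin m => P) Set.univ := measure_univ.symm
      _ ≤ (Measure.pi fun _ : Fin m => P) G + (Measure.pi fun _ : Fin m => P) Gᶜ := by
          rw [← Set.union_compl_self G]; exact measure_union_le _ _
      _ ≤ _ := by gcongr
  rw [ENNReal.ofReal_sub _ hδ.1.le, ENNReal.ofReal_one]
  exact tsub_le_iff_right.2 htotal
end
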